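/- arXiv:1408.2361 — 4 statements merged into one kernel-verified Lean document; each statement's English description precedes it below -/
import Mathlib

section
/- Let α > 1 and let (h_n)_{n≥0} be complex numbers for which there is a constant C₀ with |h_n| ≤ C₀ n^{-1} (ln n)^{-α} for all n ≥ 2. Then the series ω(μ) = Σ_{n=0}^∞ h_n μⁿ converges absolutely and uniformly on the unit circle 𝕋, and ω is logarithmically Hölder continuous with exponent α − 1: there is a constant C such that |ω(μ') − ω(μ)| ≤ C (1 + |ln |μ' − μ||)^{-(α-1)} for all μ, μ' ∈ 𝕋 with μ ≠ μ'. -/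
open Filter Topology

/-- The tangent line bound `b ^ (-β) + β b ^ (-(β + 1)) (b - a) ≤ a ^ (-β)`. -/
lemma mul_rpow_neg_mul_sub_le {a b β : ℝ} (ha : 0 < a) (hb : 0 < b) (hβ : 0 ≤ β) :
    β * b ^ (-(β + 1)) * (b - a) ≤ a ^ (-β) - b ^ (-β) := by
  have hlog : Real.log (a / b) ≤ a / b - 1 := Real.log_le_sub_one_of_pos (div_pos ha hb)
  have hexp : Real.log (a / b) * (-β) + 1 ≤ (a / b) ^ (-β) := by
    rw [Real.rpow_def_of_pos (div_pos ha hb)]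
    exact Real.add_one_le_exp _
  have hquot : 1 - β * (a / b - 1) ≤ (a / b) ^ (-β) := by
    nlinarith [mul_le_mul_of_nonneg_left hlog hβ]
  have hbpos : 0 < b ^ (-β) := Real.rpow_pos_of_pos hb _
  have hmul := mul_le_mul_of_nonneg_left hquot hbpos.le
  rw [← Real.mul_rpow hb.le (div_pos ha hb).le, mul_div_cancel₀ a hb.ne'] at hmul
  have hsplit : b ^ (-(β + 1)) = b ^ (-β) / b := by
    rw [neg_add', Real.rpow_sub_one hb.ne']
  have hrw : β * b ^ (-(β + 1)) * (b - a) = b ^ (-β) * (β * (1 - a / b)) := by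
    rw [hsplit]; field_simp
  rw [hrw]
  linarith

lemma inv_mul_log_rpow_le_sub {β : ℝ} (hβ : 0 < β) {n : ℕ} (hn : 2 ≤ n) :
    ((n + 1 : ℕ) : ℝ)⁻¹ * Real.log (n + 1 : ℕ) ^ (-(β + 1)) ≤
      β⁻¹ * (Real.log n ^ (-β) - Real.log (n + 1 : ℕ) ^ (-β)) := by
  have hn' : (2 : ℝ) ≤ n := by exact_mod_cast hn
  have hlog : 0 < Real.log n := Real.log_pos (by linarith)
  have hlog' : 0 < Real.log (n + 1 : ℕ) := Real.log_pos (by push_cast; linarith)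
  have hdiff : ((n + 1 : ℕ) : ℝ)⁻¹ ≤ Real.log (n + 1 : ℕ) - Real.log n := by
    have hle := Real.log_le_sub_one_of_pos (x := (n : ℝ) / (n + 1 : ℕ)) (by positivity)
    rw [Real.log_div (by positivity) (by positivity)] at hle
    have hrw : (n : ℝ) / (n + 1 : ℕ) - 1 = -((n + 1 : ℕ) : ℝ)⁻¹ := by
      push_cast; field_simp; ring
    linarith
  have htangent := mul_rpow_neg_mul_sub_le hlog hlog' hβ.le
  rw [inv_mul_eq_div β, le_div_iff₀ hβ]
  refine le_trans ?_ htangent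
  have hpos : 0 ≤ β * Real.log (n + 1 : ℕ) ^ (-(β + 1)) := by positivity
  nlinarith [mul_le_mul_of_nonneg_left hdiff hpos]

section LogDecay

variable {β C₀ : ℝ} {h : ℕ → ℂ}

lemma const_nonneg_of_log_decay
    (hb : ∀ n : ℕ, 2 ≤ n → ‖h n‖ ≤ C₀ * (n : ℝ)⁻¹ * Real.log n ^ (-(β + 1))) : 0 ≤ C₀ := by
  have hle := (norm_nonneg _).trans (hb 2 le_rfl)
  have hlog : 0 < Real.log (2 : ℕ) := Real.log_pos (by norm_num)
  rw [mul_assoc] at hle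
  exact nonneg_of_mul_nonneg_left hle (by positivity)

lemma sum_range_norm_tail_le (hβ : 0 < β)
    (hb : ∀ n : ℕ, 2 ≤ n → ‖h n‖ ≤ C₀ * (n : ℝ)⁻¹ * Real.log n ^ (-(β + 1)))
    {N : ℕ} (hN : 2 ≤ N) (M : ℕ) :
    ∑ n ∈ Finset.range M, ‖h (n + (N + 1))‖ ≤ C₀ * β⁻¹ * Real.log N ^ (-β) := by
  have hC := const_nonneg_of_log_decay hb
  have hlog : 0 ≤ Real.log (N + M : ℕ) := Real.log_natCast_nonneg _
  have htele : ∑ n ∈ Finset.range M, ‖h (n + (N + 1))‖ ≤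
      C₀ * β⁻¹ * (Real.log N ^ (-β) - Real.log (N + M : ℕ) ^ (-β)) := by
    clear hlog
    induction M with
    | zero => simp
    | succ M ih =>
      rw [Finset.sum_range_succ]
      have hterm := hb (M + (N + 1)) (by omega)
      have hstep := mul_le_mul_of_nonneg_left
        (inv_mul_log_rpow_le_sub hβ (show 2 ≤ N + M by omega)) hC
      rw [show M + (N + 1) = N + M + 1 by omega] at hterm ⊢
      rw [show N + (M + 1) = N + M + 1 by omega]
      linarith
  refine htele.trans (mul_le_mul_of_nonneg_left ?_ (by positivity))
  linarith [Real.rpow_nonneg hlog (-β)]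

lemma summable_norm_of_log_decay (hβ : 0 < β)
    (hb : ∀ n : ℕ, 2 ≤ n → ‖h n‖ ≤ C₀ * (n : ℝ)⁻¹ * Real.log n ^ (-(β + 1))) :
    Summable fun n => ‖h n‖ :=
  (summable_nat_add_iff (2 + 1)).1 <|
    summable_of_sum_range_le (fun _ => norm_nonneg _) (sum_range_norm_tail_le hβ hb le_rfl)

lemma exists_natCast_mul_norm_le (hβ : 0 < β)
    (hb : ∀ n : ℕ, 2 ≤ n → ‖h n‖ ≤ C₀ * (n : ℝ)⁻¹ * Real.log n ^ (-(β + 1))) :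
    ∃ K : ℝ, 0 ≤ K ∧ ∀ n : ℕ, n * ‖h n‖ ≤ K := by
  have hC := const_nonneg_of_log_decay hb
  have hlog2 : 0 < Real.log 2 := Real.log_pos (by norm_num)
  have hK : 0 ≤ C₀ * Real.log 2 ^ (-(β + 1)) := by positivity
  refine ⟨‖h 1‖ + C₀ * Real.log 2 ^ (-(β + 1)), by positivity, fun n => ?_⟩
  rcases lt_or_ge n 2 with hn | hn
  · interval_cases n
    · simp only [Nat.cast_zero, zero_mul]; positivity
    · simpa using hK
  · have hn' : (2 : ℝ) ≤ n := by exact_mod_cast hn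
    have hlog : Real.log 2 ≤ Real.log n := Real.log_le_log (by norm_num) hn'
    calc (n : ℝ) * ‖h n‖ ≤ n * (C₀ * (n : ℝ)⁻¹ * Real.log n ^ (-(β + 1))) := by
          gcongr; exact hb n hn
      _ = C₀ * Real.log n ^ (-(β + 1)) := by field_simp
      _ ≤ C₀ * Real.log 2 ^ (-(β + 1)) :=
          mul_le_mul_of_nonneg_left
            (Real.rpow_le_rpow_of_nonpos hlog2 hlog (by linarith)) hC
      _ ≤ _ := le_add_of_nonneg_left (norm_nonneg _)

end LogDecay

lemma norm_pow_sub_pow_le_of_norm_eq_one {x y : ℂ} (hx : ‖x‖ = 1) (hy : ‖y‖ = 1) (n : ℕ) :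
    ‖x ^ n - y ^ n‖ ≤ n * ‖x - y‖ := by
  induction n with
  | zero => simp
  | succ n ih =>
    calc ‖x ^ (n + 1) - y ^ (n + 1)‖ = ‖(x ^ n - y ^ n) * x + y ^ n * (x - y)‖ := by
          congr 1; ring
      _ ≤ ‖x ^ n - y ^ n‖ + ‖x - y‖ := by
          refine (norm_add_le _ _).trans ?_
          simp [hx, hy]
      _ ≤ _ := by push_cast; linarith

/-- Splitting `∑ h n (x ^ n - y ^ n)` at `N` bounds it by a Lipschitz part and a tail. -/
lemma norm_tsum_mul_pow_sub_le {h : ℕ → ℂ} (hs : Summable fun n => ‖h n‖) {K : ℝ}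
    (hK : ∀ n : ℕ, n * ‖h n‖ ≤ K) {x y : ℂ} (hx : ‖x‖ = 1) (hy : ‖y‖ = 1) (N : ℕ) :
    ‖(∑' n : ℕ, h n * x ^ n) - ∑' n : ℕ, h n * y ^ n‖ ≤
      N * (K * ‖x - y‖) + 2 * ∑' n : ℕ, ‖h (n + N)‖ := by
  have hsum : ∀ z : ℂ, ‖z‖ = 1 → Summable fun n : ℕ => h n * z ^ n := fun z hz =>
    Summable.of_norm (by simpa [hz] using hs)
  have hdiff : ∀ n, h n * x ^ n - h n * y ^ n = h n * (x ^ n - y ^ n) := fun n => by ring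
  have htwo : ∀ n, ‖h n * (x ^ n - y ^ n)‖ ≤ 2 * ‖h n‖ := fun n => by
    have hle := norm_sub_le (x ^ n) (y ^ n)
    simp only [norm_pow, hx, hy, one_pow] at hle
    rw [norm_mul]
    nlinarith [norm_nonneg (h n)]
  have hlip : ∀ n, ‖h n * (x ^ n - y ^ n)‖ ≤ K * ‖x - y‖ := fun n => by
    rw [norm_mul]
    calc ‖h n‖ * ‖x ^ n - y ^ n‖ ≤ ‖h n‖ * (n * ‖x - y‖) := by
          gcongr; exact norm_pow_sub_pow_le_of_norm_eq_one hx hy n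
      _ = n * ‖h n‖ * ‖x - y‖ := by ring
      _ ≤ _ := by gcongr; exact hK n
  have hnorm : Summable fun n => ‖h n * (x ^ n - y ^ n)‖ :=
    Summable.of_nonneg_of_le (fun _ => norm_nonneg _) htwo (hs.mul_left 2)
  rw [← (hsum x hx).tsum_sub (hsum y hy), tsum_congr hdiff]
  refine (norm_tsum_le_tsum_norm hnorm).trans ?_
  rw [← hnorm.sum_add_tsum_nat_add N, ← tsum_mul_left]
  refine add_le_add ?_ (((summable_nat_add_iff N).2 hnorm).tsum_le_tsum (fun n => htwo _)
    (((summable_nat_add_iff N).2 hs).mul_left 2))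
  simpa using Finset.sum_le_sum fun n (_ : n ∈ Finset.range N) => hlip n

lemma exp_neg_half_le_rpow {β L : ℝ} (hβ : 0 < β) (hL : 0 ≤ L) :
    Real.exp (-(L / 2)) ≤ (2 * β) ^ β * Real.exp (1 / 2) * (1 + L) ^ (-β) := by
  have hbase : 1 + L ≤ 2 * β * Real.exp ((1 + L) / (2 * β)) := by
    have hle := Real.add_one_le_exp ((1 + L) / (2 * β))
    calc 1 + L = 2 * β * ((1 + L) / (2 * β)) := by field_simp
      _ ≤ _ := by gcongr; linarith
  have hpow := Real.rpow_le_rpow (by linarith) hbase hβ.le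
  rw [Real.mul_rpow (by positivity) (Real.exp_pos _).le, ← Real.exp_mul,
    show (1 + L) / (2 * β) * β = 1 / 2 + L / 2 by field_simp, Real.exp_add] at hpow
  rw [Real.rpow_neg (by linarith), Real.exp_neg, ← div_eq_mul_inv, inv_eq_one_div,
    div_le_div_iff₀ (Real.exp_pos _) (by positivity)]
  linarith

/-- Taking `N = ⌊exp (L / 2)⌋` balances the Lipschitz part against the logarithmic tail. -/
lemma exists_nat_balance {β L : ℝ} (hβ : 0 < β) (hL : 4 ≤ L) :
    ∃ N : ℕ, 2 ≤ N ∧ ((N + 1 : ℕ) : ℝ) * Real.exp (-L) ≤ 2 * Real.exp (-(L / 2)) ∧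
      Real.log N ^ (-β) ≤ 8 ^ β * (1 + L) ^ (-β) := by
  have hx : 2 ≤ Real.exp (L / 4) := by linarith [Real.add_one_le_exp (L / 4)]
  have hsq : Real.exp (L / 2) = Real.exp (L / 4) * Real.exp (L / 4) := by
    rw [← Real.exp_add]; congr 1; ring
  have hfloor := Nat.floor_le (Real.exp_pos (L / 2)).le
  have hNx : Real.exp (L / 4) ≤ ⌊Real.exp (L / 2)⌋₊ := by
    nlinarith [Nat.lt_floor_add_one (Real.exp (L / 2))]
  refine ⟨⌊Real.exp (L / 2)⌋₊, by exact_mod_cast hx.trans hNx, ?_, ?_⟩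
  · calc ((⌊Real.exp (L / 2)⌋₊ + 1 : ℕ) : ℝ) * Real.exp (-L)
        ≤ (2 * Real.exp (L / 2)) * Real.exp (-L) := by
          gcongr; push_cast; nlinarith
      _ = 2 * Real.exp (-(L / 2)) := by
          rw [mul_assoc, ← Real.exp_add]; congr 2; ring
  · have hlog : L / 4 ≤ Real.log ⌊Real.exp (L / 2)⌋₊ :=
      (Real.le_log_iff_exp_le (by linarith)).2 hNx
    have hle : (1 + L) / 8 ≤ Real.log ⌊Real.exp (L / 2)⌋₊ := by linarith
    refine (Real.rpow_le_rpow_of_nonpos (by linarith) hle (by linarith)).trans_eq ?_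
    rw [Real.div_rpow (by linarith) (by norm_num), Real.rpow_neg (by norm_num : (0 : ℝ) ≤ 8),
      div_inv_eq_mul, mul_comm]

/-- If `|h n| ≤ C₀ n⁻¹ (log n)^{-α}` with `α > 1`, then the series
`ω(μ) = ∑ h n μ^n` converges absolutely and uniformly on the unit circle, and its sum
is logarithmically Hölder continuous with exponent `α - 1`. -/
theorem stmt_0 (α : ℝ) (hα : 1 < α) (h : ℕ → ℂ) (C₀ : ℝ)
    (hb : ∀ n : ℕ, 2 ≤ n → ‖h n‖ ≤ C₀ * (n : ℝ)⁻¹ * Real.log n ^ (-α)) :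
    (∀ μ : ℂ, ‖μ‖ = 1 → Summable fun n : ℕ => ‖h n * μ ^ n‖) ∧
    TendstoUniformlyOn (fun (N : ℕ) (μ : ℂ) => ∑ n ∈ Finset.range N, h n * μ ^ n)
      (fun μ : ℂ => ∑' n : ℕ, h n * μ ^ n) atTop {μ : ℂ | ‖μ‖ = 1} ∧
    ∃ C : ℝ, ∀ μ μ' : ℂ, ‖μ‖ = 1 → ‖μ'‖ = 1 → μ ≠ μ' →
      ‖(∑' n : ℕ, h n * μ' ^ n) - ∑' n : ℕ, h n * μ ^ n‖ ≤
        C * (1 + |Real.log ‖μ' - μ‖|) ^ (-(α - 1)) := by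
  obtain ⟨β, rfl⟩ : ∃ β, α = β + 1 := ⟨α - 1, by ring⟩
  have hβ : 0 < β := by linarith
  have hs := summable_norm_of_log_decay hβ hb
  refine ⟨fun μ hμ => by simpa [hμ] using hs,
    tendstoUniformlyOn_tsum_nat hs fun n μ (hμ : ‖μ‖ = 1) => by simp [hμ], ?_⟩
  obtain ⟨K, hK0, hK⟩ := exists_natCast_mul_norm_le hβ hb
  have hC := const_nonneg_of_log_decay hb
  have hS : 0 ≤ ∑' n, ‖h n‖ := tsum_nonneg fun _ => norm_nonneg _
  set A := 2 * (∑' n, ‖h n‖) * 5 ^ β with hA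
  set B := K * (2 * ((2 * β) ^ β * Real.exp (1 / 2))) + 2 * (C₀ * β⁻¹ * 8 ^ β) with hB
  have hA0 : 0 ≤ A := by positivity
  have hB0 : 0 ≤ B := by positivity
  refine ⟨A + B, fun μ μ' hμ hμ' hne => ?_⟩
  rw [add_sub_cancel_right]
  have hδ : 0 < ‖μ' - μ‖ := norm_pos_iff.2 (sub_ne_zero.2 hne.symm)
  have hrpow : 0 ≤ (1 + |Real.log ‖μ' - μ‖|) ^ (-β) := by positivity
  rcases le_or_gt |Real.log ‖μ' - μ‖| 4 with hle | hgt
  · have hbound := norm_tsum_mul_pow_sub_le hs hK hμ' hμ 0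
    simp only [Nat.cast_zero, zero_mul, zero_add, add_zero] at hbound
    have hmono : (5 : ℝ) ^ (-β) ≤ (1 + |Real.log ‖μ' - μ‖|) ^ (-β) :=
      Real.rpow_le_rpow_of_nonpos (by positivity) (by linarith) (by linarith)
    calc _ ≤ 2 * ∑' n, ‖h n‖ := hbound
      _ = A * 5 ^ (-β) := by
          rw [hA, mul_assoc _ ((5 : ℝ) ^ β), ← Real.rpow_add (by norm_num)]; simp
      _ ≤ A * (1 + |Real.log ‖μ' - μ‖|) ^ (-β) := by gcongr
      _ ≤ _ := by gcongr; linarith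
  · have htwo : ‖μ' - μ‖ ≤ 2 := (norm_sub_le _ _).trans (by rw [hμ, hμ']; norm_num)
    have hlog := Real.log_le_sub_one_of_pos hδ
    have habs : |Real.log ‖μ' - μ‖| = -Real.log ‖μ' - μ‖ := by
      rcases abs_cases (Real.log ‖μ' - μ‖) with ⟨h1, _⟩ | ⟨h1, _⟩ <;> linarith
    set L := |Real.log ‖μ' - μ‖| with hL
    have hδL : ‖μ' - μ‖ = Real.exp (-L) := by rw [habs, neg_neg, Real.exp_log hδ]
    obtain ⟨N, hN, hhead, htail⟩ := exists_nat_balance hβ hgt.le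
    have hexp := exp_neg_half_le_rpow hβ (abs_nonneg (Real.log ‖μ' - μ‖))
    rw [← hL] at hexp
    calc _ ≤ (N + 1 : ℕ) * (K * ‖μ' - μ‖) + 2 * ∑' n : ℕ, ‖h (n + (N + 1))‖ :=
          norm_tsum_mul_pow_sub_le hs hK hμ' hμ (N + 1)
      _ = K * ((N + 1 : ℕ) * Real.exp (-L)) + 2 * ∑' n : ℕ, ‖h (n + (N + 1))‖ := by
          rw [hδL]; ring
      _ ≤ K * (2 * ((2 * β) ^ β * Real.exp (1 / 2) * (1 + L) ^ (-β))) +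
            2 * (C₀ * β⁻¹ * (8 ^ β * (1 + L) ^ (-β))) := by
          refine add_le_add (mul_le_mul_of_nonneg_left ?_ hK0)
            (mul_le_mul_of_nonneg_left ?_ zero_le_two)
          · exact hhead.trans (by gcongr)
          · exact (Real.tsum_le_of_sum_range_le (fun _ => norm_nonneg _)
              (sum_range_norm_tail_le hβ hb hN)).trans (by gcongr)
      _ = B * (1 + L) ^ (-β) := by rw [hB]; ring
      _ ≤ _ := by gcongr; linarith
end

section
/- The function ζ has the following properties: (i) for every real ν the improper integral defining ζ(ν) converges, i.e. the limit lim_{T→∞} ∫₀^T sin(νt)/(2+t) dt exists; (ii) lim_{ν→0+} ζ(ν) = 1/2; (iii) there is a constant C with |ζ(ν)| ≤ C ν^{-1} for all ν ≥ 1; (iv) ζ is differentiable on (0,∞) and there is a constant C with |ζ'(ν)| ≤ C (1 + |ln ν|) for all 0 < ν ≤ 1/2. -/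
open Filter Topology MeasureTheory

/-- `ζ(ν) = π⁻¹ lim_{T→∞} ∫₀^T sin(νt)/(2+t) dt`. -/
noncomputable def zeta (ν : ℝ) : ℝ :=
  Real.pi⁻¹ * limUnder atTop fun T : ℝ => ∫ t in (0 : ℝ)..T, Real.sin (ν * t) / (2 + t)

/-- The Laplace transform of `s ↦ (1 + s ^ 2)⁻¹`, evaluated at `2 * ν`. -/
noncomputable def laplaceInvOneAddSq (ν : ℝ) : ℝ :=
  ∫ s in Set.Ioi (0 : ℝ), Real.exp (-(2 * ν) * s) * (1 + s ^ 2)⁻¹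

lemma inv_one_add_sq_le_one (s : ℝ) : (1 + s ^ 2)⁻¹ ≤ 1 :=
  inv_le_one_of_one_le₀ (by nlinarith [sq_nonneg s])

lemma integral_exp_neg_mul_Ioi_zero {b : ℝ} (hb : 0 < b) :
    ∫ s in Set.Ioi (0 : ℝ), Real.exp (-b * s) = b⁻¹ := by
  rw [integral_exp_mul_Ioi (by linarith)]
  simp [neg_div_neg_eq]

lemma integrableOn_exp_mul_inv_one_add_sq {ν : ℝ} (hν : 0 < ν) :
    IntegrableOn (fun s : ℝ => Real.exp (-(2 * ν) * s) * (1 + s ^ 2)⁻¹) (Set.Ioi 0) := by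
  refine Integrable.mono' (exp_neg_integrableOn_Ioi 0 (b := 2 * ν) (by linarith))
    (by fun_prop) (ae_of_all _ fun s => ?_)
  rw [Real.norm_of_nonneg (by positivity)]
  exact mul_le_of_le_one_right (Real.exp_nonneg _) (inv_one_add_sq_le_one s)

lemma intervalIntegral_sin_mul_exp (ν s T : ℝ) :
    ∫ t in (0 : ℝ)..T, Real.sin (ν * t) * (ν * Real.exp (-((2 + t) * ν) * s)) =
      Real.exp (-(2 * ν) * s) *
        ((1 - Real.exp (-(ν * T) * s) * (s * Real.sin (ν * T) + Real.cos (ν * T))) *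
          (1 + s ^ 2)⁻¹) := by
  have hs : (1 + s ^ 2 : ℝ) ≠ 0 := by positivity
  have hderiv : ∀ t ∈ Set.uIcc 0 T, HasDerivAt
      (fun t : ℝ => -(Real.exp (-((2 + t) * ν) * s) *
        (s * Real.sin (ν * t) + Real.cos (ν * t))) * (1 + s ^ 2)⁻¹)
      (Real.sin (ν * t) * (ν * Real.exp (-((2 + t) * ν) * s))) t := by
    intro t _
    have hlin : HasDerivAt (fun t : ℝ => ν * t) ν t := by
      simpa using (hasDerivAt_id t).const_mul ν
    have hexp : HasDerivAt (fun t : ℝ => Real.exp (-((2 + t) * ν) * s))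
        (Real.exp (-((2 + t) * ν) * s) * (-(1 * ν) * s)) t :=
      (((((hasDerivAt_id t).const_add 2).mul_const ν).neg).mul_const s).exp
    refine (((hexp.mul ((hlin.sin.const_mul s).add hlin.cos)).neg).mul_const
      (1 + s ^ 2)⁻¹).congr_deriv ?_
    simp only [Pi.add_apply]
    field_simp
    ring
  rw [intervalIntegral.integral_eq_sub_of_hasDerivAt hderiv
    (Continuous.intervalIntegrable (by fun_prop) _ _)]
  have hsplit : Real.exp (-((2 + T) * ν) * s) =
      Real.exp (-(2 * ν) * s) * Real.exp (-(ν * T) * s) := by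
    rw [← Real.exp_add]; ring_nf
  rw [hsplit]
  simp only [add_zero, mul_zero, Real.sin_zero, Real.cos_zero, zero_add, mul_one]
  ring

lemma intervalIntegral_sin_div_eq {ν T : ℝ} (hν : 0 < ν) (hT : 0 ≤ T) :
    ∫ t in (0 : ℝ)..T, Real.sin (ν * t) / (2 + t) =
      ∫ s in Set.Ioi (0 : ℝ), Real.exp (-(2 * ν) * s) *
        ((1 - Real.exp (-(ν * T) * s) * (s * Real.sin (ν * T) + Real.cos (ν * T))) *
          (1 + s ^ 2)⁻¹) := by
  have hint : Integrable
      (Function.uncurry fun t s : ℝ => Real.sin (ν * t) * (ν * Real.exp (-((2 + t) * ν) * s)))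
      ((volume.restrict (Set.Ioc 0 T)).prod (volume.restrict (Set.Ioi 0))) := by
    have hdom : Integrable (fun z : ℝ × ℝ => (1 : ℝ) * (ν * Real.exp (-(2 * ν) * z.2)))
        ((volume.restrict (Set.Ioc 0 T)).prod (volume.restrict (Set.Ioi 0))) :=
      (integrable_const (1 : ℝ)).mul_prod
        ((exp_neg_integrableOn_Ioi 0 (b := 2 * ν) (by linarith)).const_mul ν)
    refine hdom.mono' (by unfold Function.uncurry; fun_prop) ?_
    rw [Measure.prod_restrict]
    filter_upwards [ae_restrict_mem (measurableSet_Ioc.prod measurableSet_Ioi)] with z hz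
    obtain ⟨⟨ht, -⟩, hs⟩ := hz
    have hs : 0 < z.2 := hs
    simp only [Function.uncurry, norm_mul, Real.norm_eq_abs, Real.abs_exp, abs_of_pos hν]
    gcongr
    · exact Real.abs_sin_le_one _
    · nlinarith [mul_pos ht hν]
  calc
    _ = ∫ t in Set.Ioc 0 T, ∫ s in Set.Ioi (0 : ℝ),
          Real.sin (ν * t) * (ν * Real.exp (-((2 + t) * ν) * s)) := by
      rw [intervalIntegral.integral_of_le hT]
      refine setIntegral_congr_fun measurableSet_Ioc fun t ht => ?_
      have h2 : 0 < 2 + t := by linarith [ht.1]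
      simp only [integral_const_mul, integral_exp_neg_mul_Ioi_zero (mul_pos h2 hν)]
      field_simp
    _ = ∫ s in Set.Ioi (0 : ℝ), ∫ t in Set.Ioc 0 T,
          Real.sin (ν * t) * (ν * Real.exp (-((2 + t) * ν) * s)) := integral_integral_swap hint
    _ = _ := by
      simp only [← intervalIntegral.integral_of_le hT, intervalIntegral_sin_mul_exp]

lemma abs_intervalIntegral_sin_div_sub_le {ν T : ℝ} (hν : 0 < ν) (hT : 0 < T) :
    |(∫ t in (0 : ℝ)..T, Real.sin (ν * t) / (2 + t)) - laplaceInvOneAddSq ν| ≤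
      2 * (ν * T)⁻¹ := by
  have hνT : 0 < ν * T := mul_pos hν hT
  have hbound : ∀ s ∈ Set.Ioi (0 : ℝ),
      ‖Real.exp (-(2 * ν) * s) * (1 + s ^ 2)⁻¹ *
        (Real.exp (-(ν * T) * s) * (s * Real.sin (ν * T) + Real.cos (ν * T)))‖ ≤
      2 * Real.exp (-(ν * T) * s) := by
    intro s hs
    have hs : 0 < s := hs
    have htrig : |s * Real.sin (ν * T) + Real.cos (ν * T)| ≤ s + 1 := by
      refine (abs_add_le _ _).trans (add_le_add ?_ (Real.abs_cos_le_one _))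
      rw [abs_mul, abs_of_pos hs]
      exact mul_le_of_le_one_right hs.le (Real.abs_sin_le_one _)
    have hrat : (1 + s ^ 2)⁻¹ * (s + 1) ≤ 2 := by
      rw [inv_mul_le_iff₀ (by positivity)]
      nlinarith [sq_nonneg (s - 1), sq_nonneg s]
    have hexp : Real.exp (-(2 * ν) * s) ≤ 1 :=
      Real.exp_le_one_iff.2 (by nlinarith [mul_pos hν hs])
    have hinv : 0 < (1 + s ^ 2)⁻¹ := by positivity
    simp only [norm_mul, Real.norm_eq_abs, Real.abs_exp, abs_of_pos hinv]
    calc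
      _ ≤ 1 * (1 + s ^ 2)⁻¹ * (Real.exp (-(ν * T) * s) * (s + 1)) := by gcongr
      _ = (1 + s ^ 2)⁻¹ * (s + 1) * Real.exp (-(ν * T) * s) := by ring
      _ ≤ _ := by gcongr
  have hdom := (exp_neg_integrableOn_Ioi 0 hνT).const_mul 2
  have hrem : IntegrableOn (fun s : ℝ => Real.exp (-(2 * ν) * s) * (1 + s ^ 2)⁻¹ *
      (Real.exp (-(ν * T) * s) * (s * Real.sin (ν * T) + Real.cos (ν * T)))) (Set.Ioi 0) :=
    hdom.mono' (by fun_prop) ((ae_restrict_iff' measurableSet_Ioi).2 (ae_of_all _ hbound))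
  have hsplit : (∫ t in (0 : ℝ)..T, Real.sin (ν * t) / (2 + t)) = laplaceInvOneAddSq ν -
      ∫ s in Set.Ioi (0 : ℝ), Real.exp (-(2 * ν) * s) * (1 + s ^ 2)⁻¹ *
        (Real.exp (-(ν * T) * s) * (s * Real.sin (ν * T) + Real.cos (ν * T))) := by
    rw [intervalIntegral_sin_div_eq hν hT.le, laplaceInvOneAddSq,
      ← integral_sub (integrableOn_exp_mul_inv_one_add_sq hν) hrem]
    congr 1
    ext s
    ring
  rw [hsplit, sub_sub_cancel_left, abs_neg, ← Real.norm_eq_abs]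
  refine (norm_integral_le_of_norm_le hdom
    ((ae_restrict_iff' measurableSet_Ioi).2 (ae_of_all _ hbound))).trans_eq ?_
  rw [integral_const_mul, integral_exp_neg_mul_Ioi_zero hνT]

lemma tendsto_intervalIntegral_sin_div {ν : ℝ} (hν : 0 < ν) :
    Tendsto (fun T : ℝ => ∫ t in (0 : ℝ)..T, Real.sin (ν * t) / (2 + t)) atTop
      (𝓝 (laplaceInvOneAddSq ν)) := by
  rw [tendsto_iff_norm_sub_tendsto_zero]
  have hlim : Tendsto (fun T : ℝ => 2 * (ν * T)⁻¹) atTop (𝓝 0) := by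
    simpa using ((tendsto_id.const_mul_atTop hν).inv_tendsto_atTop).const_mul (2 : ℝ)
  refine squeeze_zero' (Eventually.of_forall fun _ => norm_nonneg _) ?_ hlim
  filter_upwards [eventually_gt_atTop 0] with T hT
  exact abs_intervalIntegral_sin_div_sub_le hν hT

lemma exists_tendsto_intervalIntegral_sin_div (ν : ℝ) :
    ∃ L : ℝ, Tendsto (fun T : ℝ => ∫ t in (0 : ℝ)..T, Real.sin (ν * t) / (2 + t)) atTop
      (𝓝 L) := by
  rcases lt_trichotomy ν 0 with hν | rfl | hν
  · refine ⟨-laplaceInvOneAddSq (-ν), ?_⟩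
    simpa [neg_div] using (tendsto_intervalIntegral_sin_div (neg_pos.2 hν)).neg
  · exact ⟨0, by simp⟩
  · exact ⟨_, tendsto_intervalIntegral_sin_div hν⟩

lemma zeta_eq_laplace {ν : ℝ} (hν : 0 < ν) : zeta ν = Real.pi⁻¹ * laplaceInvOneAddSq ν := by
  rw [zeta, (tendsto_intervalIntegral_sin_div hν).limUnder_eq]

lemma tendsto_laplaceInvOneAddSq :
    Tendsto laplaceInvOneAddSq (𝓝[>] 0) (𝓝 (Real.pi / 2)) := by
  have hval : ∫ s in Set.Ioi (0 : ℝ), (1 + s ^ 2)⁻¹ = Real.pi / 2 := by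
    rw [integral_Ioi_inv_one_add_sq, Real.arctan_zero, sub_zero]
  rw [← hval]
  refine tendsto_integral_filter_of_dominated_convergence (fun s : ℝ => (1 + s ^ 2)⁻¹)
    (Eventually.of_forall fun ν => by fun_prop) ?_ integrable_inv_one_add_sq.integrableOn
    (ae_of_all _ fun s => ?_)
  · filter_upwards [self_mem_nhdsWithin] with ν hν
    filter_upwards [ae_restrict_mem measurableSet_Ioi] with s hs
    rw [Real.norm_of_nonneg (by positivity)]
    refine mul_le_of_le_one_left (by positivity) (Real.exp_le_one_iff.2 ?_)
    nlinarith [mul_pos (Set.mem_Ioi.1 hν) (Set.mem_Ioi.1 hs)]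
  · have hcont : Continuous fun ν : ℝ => Real.exp (-(2 * ν) * s) * (1 + s ^ 2)⁻¹ := by fun_prop
    simpa using (hcont.tendsto 0).mono_left nhdsWithin_le_nhds

lemma laplaceInvOneAddSq_nonneg (ν : ℝ) : 0 ≤ laplaceInvOneAddSq ν :=
  integral_nonneg fun s => by positivity

lemma laplaceInvOneAddSq_le {ν : ℝ} (hν : 0 < ν) : laplaceInvOneAddSq ν ≤ (2 * ν)⁻¹ := by
  have h2ν : 0 < 2 * ν := by linarith
  rw [← integral_exp_neg_mul_Ioi_zero h2ν]
  exact integral_mono (integrableOn_exp_mul_inv_one_add_sq hν) (exp_neg_integrableOn_Ioi 0 h2ν)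
    fun s => mul_le_of_le_one_right (Real.exp_nonneg _) (inv_one_add_sq_le_one s)

lemma two_mul_mul_inv_one_add_sq_le_one (s : ℝ) : 2 * s * (1 + s ^ 2)⁻¹ ≤ 1 := by
  rw [← div_eq_mul_inv, div_le_one (by positivity)]
  nlinarith [sq_nonneg (s - 1)]

lemma hasDerivAt_laplaceInvOneAddSq {ν : ℝ} (hν : 0 < ν) :
    IntegrableOn (fun s : ℝ => -(Real.exp (-(2 * ν) * s) * (2 * s * (1 + s ^ 2)⁻¹)))
        (Set.Ioi 0) ∧
      HasDerivAt laplaceInvOneAddSq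
        (∫ s in Set.Ioi (0 : ℝ), -(Real.exp (-(2 * ν) * s) * (2 * s * (1 + s ^ 2)⁻¹))) ν := by
  refine hasDerivAt_integral_of_dominated_loc_of_deriv_le (s := Set.Ioi (ν / 2))
    (F := fun ν s : ℝ => Real.exp (-(2 * ν) * s) * (1 + s ^ 2)⁻¹)
    (F' := fun ν s : ℝ => -(Real.exp (-(2 * ν) * s) * (2 * s * (1 + s ^ 2)⁻¹)))
    (bound := fun s => Real.exp (-ν * s)) (Ioi_mem_nhds (by linarith))
    (Eventually.of_forall fun x => by fun_prop) (integrableOn_exp_mul_inv_one_add_sq hν)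
    (by fun_prop) ?_ (exp_neg_integrableOn_Ioi 0 hν) (ae_of_all _ fun s x _ => ?_)
  · filter_upwards [ae_restrict_mem measurableSet_Ioi] with s hs x hx
    have hs : 0 < s := hs
    have hx : ν / 2 < x := hx
    rw [norm_neg, Real.norm_of_nonneg (by positivity)]
    refine (mul_le_of_le_one_right (Real.exp_nonneg _)
      (two_mul_mul_inv_one_add_sq_le_one s)).trans (Real.exp_le_exp.2 ?_)
    nlinarith
  · have hexp : HasDerivAt (fun x : ℝ => Real.exp (-(2 * x) * s))
        (Real.exp (-(2 * x) * s) * (-(2 * 1) * s)) x :=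
      ((((hasDerivAt_id x).const_mul 2).neg).mul_const s).exp
    refine (hexp.mul_const (1 + s ^ 2)⁻¹).congr_deriv ?_
    ring

lemma intervalIntegral_two_mul_inv_one_add_sq (R : ℝ) :
    ∫ s in (0 : ℝ)..R, 2 * s * (1 + s ^ 2)⁻¹ = Real.log (1 + R ^ 2) := by
  have hderiv : ∀ s ∈ Set.uIcc 0 R,
      HasDerivAt (fun s : ℝ => Real.log (1 + s ^ 2)) (2 * s * (1 + s ^ 2)⁻¹) s := by
    intro s _
    have hpow : HasDerivAt (fun s : ℝ => 1 + s ^ 2) (2 * s) s := by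
      simpa using (hasDerivAt_pow 2 s).const_add 1
    simpa [div_eq_mul_inv] using hpow.log (by positivity)
  have hcont : Continuous fun s : ℝ => 2 * s * (1 + s ^ 2)⁻¹ :=
    (by fun_prop : Continuous fun s : ℝ => 2 * s).mul
      ((by fun_prop : Continuous fun s : ℝ => 1 + s ^ 2).inv₀ fun s => by positivity)
  rw [intervalIntegral.integral_eq_sub_of_hasDerivAt hderiv (hcont.intervalIntegrable _ _)]
  simp

lemma setIntegral_exp_mul_two_mul_inv_one_add_sq_le {ν : ℝ} (hν : 0 < ν) :
    ∫ s in Set.Ioi (0 : ℝ), Real.exp (-(2 * ν) * s) * (2 * s * (1 + s ^ 2)⁻¹) ≤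
      Real.log (1 + ν⁻¹ ^ 2) + 1 := by
  have h2ν : 0 < 2 * ν := by linarith
  have hinv : 0 < ν⁻¹ := inv_pos.2 hν
  have hint : IntegrableOn (fun s : ℝ => Real.exp (-(2 * ν) * s) * (2 * s * (1 + s ^ 2)⁻¹))
      (Set.Ioi 0) := by
    simpa using (hasDerivAt_laplaceInvOneAddSq hν).1.neg
  have hcont : Continuous fun s : ℝ => 2 * s * (1 + s ^ 2)⁻¹ :=
    (by fun_prop : Continuous fun s : ℝ => 2 * s).mul
      ((by fun_prop : Continuous fun s : ℝ => 1 + s ^ 2).inv₀ fun s => by positivity)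
  have hsub : Set.Ioi ν⁻¹ ⊆ Set.Ioi (0 : ℝ) := Set.Ioi_subset_Ioi hinv.le
  rw [← Set.Ioc_union_Ioi_eq_Ioi hinv.le,
    setIntegral_union (Set.Ioc_disjoint_Ioi le_rfl) measurableSet_Ioi
      (hint.mono_set Set.Ioc_subset_Ioi_self) (hint.mono_set hsub)]
  refine add_le_add ?_ ?_
  · rw [← intervalIntegral_two_mul_inv_one_add_sq, intervalIntegral.integral_of_le hinv.le]
    refine setIntegral_mono_on (hint.mono_set Set.Ioc_subset_Ioi_self)
      hcont.integrableOn_Ioc measurableSet_Ioc fun s hs => ?_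
    have hs : 0 < s := hs.1
    refine mul_le_of_le_one_left (by positivity) (Real.exp_le_one_iff.2 ?_)
    nlinarith [mul_pos hν hs]
  · have hexp : IntegrableOn (fun s : ℝ => Real.exp (-(2 * ν) * s) * (2 * ν)) (Set.Ioi 0) :=
      (exp_neg_integrableOn_Ioi 0 h2ν).mul_const _
    calc
      _ ≤ ∫ s in Set.Ioi ν⁻¹, Real.exp (-(2 * ν) * s) * (2 * ν) := by
        refine setIntegral_mono_on (hint.mono_set hsub) (hexp.mono_set hsub)
          measurableSet_Ioi fun s hs => ?_
        have hs0 : 0 < s := hsub hs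
        have hsν : 1 ≤ ν * s := by
          have := mul_lt_mul_of_pos_left (Set.mem_Ioi.1 hs) hν
          rw [mul_inv_cancel₀ hν.ne'] at this
          exact this.le
        refine mul_le_mul_of_nonneg_left ?_ (Real.exp_nonneg _)
        rw [← div_eq_mul_inv, div_le_iff₀ (by positivity)]
        nlinarith
      _ ≤ ∫ s in Set.Ioi (0 : ℝ), Real.exp (-(2 * ν) * s) * (2 * ν) :=
        setIntegral_mono_set hexp (ae_of_all _ fun s => by positivity) hsub.eventuallyLE
      _ = 1 := by
        rw [integral_mul_const, integral_exp_neg_mul_Ioi_zero h2ν, inv_mul_cancel₀ h2ν.ne']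

lemma log_one_add_inv_sq_le {ν : ℝ} (hν : 0 < ν) (hν1 : ν ≤ 1) :
    Real.log (1 + ν⁻¹ ^ 2) ≤ 1 + 2 * |Real.log ν| := by
  have hone : 1 ≤ ν⁻¹ ^ 2 := one_le_pow₀ ((one_le_inv₀ hν).2 hν1)
  calc
    Real.log (1 + ν⁻¹ ^ 2) ≤ Real.log (2 * ν⁻¹ ^ 2) :=
      Real.log_le_log (by positivity) (by linarith)
    _ = Real.log 2 + 2 * -Real.log ν := by
      rw [Real.log_mul (by norm_num) (by positivity), Real.log_pow, Real.log_inv]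
      norm_num
    _ ≤ 1 + 2 * |Real.log ν| := by
      linarith [Real.log_two_lt_d9, neg_le_abs (Real.log ν)]

lemma hasDerivAt_zeta {ν : ℝ} (hν : 0 < ν) :
    HasDerivAt zeta (Real.pi⁻¹ *
      ∫ s in Set.Ioi (0 : ℝ), -(Real.exp (-(2 * ν) * s) * (2 * s * (1 + s ^ 2)⁻¹))) ν := by
  refine ((hasDerivAt_laplaceInvOneAddSq hν).2.const_mul Real.pi⁻¹).congr_of_eventuallyEq ?_
  filter_upwards [Ioi_mem_nhds hν] with x hx using zeta_eq_laplace hx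

lemma inv_pi_le_one : Real.pi⁻¹ ≤ 1 :=
  inv_le_one_of_one_le₀ (by linarith [Real.pi_gt_three])

/-- Properties of `ζ`: (i) the defining improper integral converges for
every `ν`; (ii) `ζ(ν) → 1/2` as `ν → 0+`; (iii) `|ζ(ν)| ≤ C ν⁻¹` for `ν ≥ 1`;
(iv) `ζ` is differentiable on `(0,∞)` and `|ζ'(ν)| ≤ C (1 + |log ν|)` for `0 < ν ≤ 1/2`. -/
theorem stmt_4 :
    (∀ ν : ℝ, ∃ L : ℝ,
      Tendsto (fun T : ℝ => ∫ t in (0 : ℝ)..T, Real.sin (ν * t) / (2 + t)) atTop (nhds L)) ∧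
    Tendsto zeta (nhdsWithin 0 (Set.Ioi 0)) (nhds (1 / 2)) ∧
    (∃ C : ℝ, ∀ ν : ℝ, 1 ≤ ν → |zeta ν| ≤ C * ν⁻¹) ∧
    (∀ ν : ℝ, 0 < ν → DifferentiableAt ℝ zeta ν) ∧
    (∃ C : ℝ, ∀ ν : ℝ, 0 < ν → ν ≤ 1 / 2 → |deriv zeta ν| ≤ C * (1 + |Real.log ν|)) := by
  refine ⟨exists_tendsto_intervalIntegral_sin_div, ?_, ⟨1, fun ν hν => ?_⟩,
    fun ν hν => (hasDerivAt_zeta hν).differentiableAt, ⟨3, fun ν hν hν2 => ?_⟩⟩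
  · have hlim : Real.pi⁻¹ * (Real.pi / 2) = 1 / 2 := by
      field_simp [Real.pi_ne_zero]
    rw [← hlim]
    refine (tendsto_laplaceInvOneAddSq.const_mul Real.pi⁻¹).congr' ?_
    filter_upwards [self_mem_nhdsWithin] with ν hν using (zeta_eq_laplace hν).symm
  · have hν0 : 0 < ν := by linarith
    have hpi : 0 < Real.pi⁻¹ := inv_pos.2 Real.pi_pos
    rw [zeta_eq_laplace hν0, abs_of_nonneg (mul_nonneg hpi.le (laplaceInvOneAddSq_nonneg ν))]
    refine mul_le_mul inv_pi_le_one ((laplaceInvOneAddSq_le hν0).trans ?_)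
      (laplaceInvOneAddSq_nonneg ν) zero_le_one
    exact inv_anti₀ hν0 (by linarith)
  · have hnonneg : 0 ≤ ∫ s in Set.Ioi (0 : ℝ),
        Real.exp (-(2 * ν) * s) * (2 * s * (1 + s ^ 2)⁻¹) :=
      setIntegral_nonneg measurableSet_Ioi fun s hs => by
        have hs : 0 < s := hs
        positivity
    have hpi : 0 < Real.pi⁻¹ := inv_pos.2 Real.pi_pos
    rw [(hasDerivAt_zeta hν).deriv, integral_neg, mul_neg, abs_neg,
      abs_of_nonneg (mul_nonneg hpi.le hnonneg)]
    refine (mul_le_of_le_one_left hnonneg inv_pi_le_one).trans ?_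
    linarith [setIntegral_exp_mul_two_mul_inv_one_add_sq_le hν,
      log_one_add_inv_sq_le hν (by linarith), abs_nonneg (Real.log ν)]
end

section
/- For every real t ≠ 0, lim_{R→∞} ∫_{-R}^{R} ζ(ν) e^{-iνt} dν = −i · sgn(t)/(2 + |t|). Equivalently, since ζ is odd, for every t > 0, lim_{R→∞} ∫₀^R ζ(ν) sin(νt) dν = 1/(2(2+t)). -/
open Filter Topology MeasureTheory

theorem integral_sin_mul_exp_neg {a : ℝ} (ha : 0 < a) (x T : ℝ) :
    ∫ s in (0 : ℝ)..T, Real.sin (a * s) * Real.exp (-x * s) =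
      (a - Real.exp (-x * T) * (a * Real.cos (a * T) + x * Real.sin (a * T))) /
        (a ^ 2 + x ^ 2) := by
  have hne : a ^ 2 + x ^ 2 ≠ 0 := by positivity
  have hd : ∀ s ∈ Set.uIcc 0 T, HasDerivAt
      (fun s => -(Real.exp (-x * s) * (a * Real.cos (a * s) + x * Real.sin (a * s))) /
        (a ^ 2 + x ^ 2)) (Real.sin (a * s) * Real.exp (-x * s)) s := by
    intro s _
    have h1 : HasDerivAt (fun s => -x * s) (-x) s := by
      simpa using (hasDerivAt_id s).const_mul (-x)
    have h2 : HasDerivAt (fun s => a * s) a s := by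
      simpa using (hasDerivAt_id s).const_mul a
    refine (((h1.exp.mul ((h2.cos.const_mul a).add (h2.sin.const_mul x))).neg).div_const
      (a ^ 2 + x ^ 2)).congr_deriv ?_
    simp only [Pi.add_apply]
    field_simp
    ring
  rw [intervalIntegral.integral_eq_sub_of_hasDerivAt hd
    (by apply Continuous.intervalIntegrable; fun_prop)]
  simp
  ring

theorem integrable_prod_exp_neg_mul {g : ℝ → ℝ} (hg : IntegrableOn g (Set.Ioi 0)) (T : ℝ) :
    Integrable (fun p : ℝ × ℝ => Real.exp (-p.2 * p.1) * g p.2)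
      ((volume.restrict (Set.Ioc 0 T)).prod (volume.restrict (Set.Ioi 0))) := by
  have h : Integrable (fun p : ℝ × ℝ => (1 : ℝ) * g p.2)
      ((volume.restrict (Set.Ioc 0 T)).prod (volume.restrict (Set.Ioi 0))) :=
    (integrable_const (1 : ℝ)).mul_prod hg
  refine h.mono ?_ ?_
  · refine AEStronglyMeasurable.mul (by fun_prop) ?_
    simpa using h.aestronglyMeasurable
  · rw [Measure.prod_restrict]
    filter_upwards [ae_restrict_mem (measurableSet_Ioc.prod measurableSet_Ioi)] with p hp
    rw [norm_mul, norm_mul]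
    refine mul_le_mul_of_nonneg_right ?_ (norm_nonneg _)
    rw [Real.norm_of_nonneg (Real.exp_pos _).le, norm_one]
    apply Real.exp_le_one_iff.2
    have := mul_pos (show 0 < p.2 from hp.2) hp.1.1
    linarith

/-- The sine transform of a Laplace transform, as an improper integral. -/
theorem tendsto_integral_sin_mul_laplace {g : ℝ → ℝ} (hg : IntegrableOn g (Set.Ioi 0))
    {a : ℝ} (ha : 0 < a) :
    Tendsto (fun T : ℝ => ∫ s in (0 : ℝ)..T,
        (∫ x in Set.Ioi (0 : ℝ), Real.exp (-x * s) * g x) * Real.sin (a * s))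
      atTop (𝓝 (∫ x in Set.Ioi (0 : ℝ), g x * (a / (a ^ 2 + x ^ 2)))) := by
  have key : ∀ T : ℝ, 0 ≤ T → ∫ s in (0 : ℝ)..T,
      (∫ x in Set.Ioi (0 : ℝ), Real.exp (-x * s) * g x) * Real.sin (a * s) =
      ∫ x in Set.Ioi (0 : ℝ), g x *
        ((a - Real.exp (-x * T) * (a * Real.cos (a * T) + x * Real.sin (a * T))) /
          (a ^ 2 + x ^ 2)) := by
    intro T hT
    have hint : Integrable (fun p : ℝ × ℝ => Real.exp (-p.2 * p.1) * g p.2 * Real.sin (a * p.1))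
        ((volume.restrict (Set.Ioc 0 T)).prod (volume.restrict (Set.Ioi 0))) := by
      refine (integrable_prod_exp_neg_mul hg T).mul_bdd (c := 1) (by fun_prop) ?_
      exact Eventually.of_forall fun p => Real.abs_sin_le_one _
    rw [intervalIntegral.integral_of_le hT]
    simp_rw [← integral_mul_const]
    rw [integral_integral_swap hint]
    refine integral_congr_ae (Eventually.of_forall fun x => ?_)
    dsimp only
    rw [← integral_sin_mul_exp_neg ha, intervalIntegral.integral_of_le hT, ← integral_const_mul]
    refine integral_congr_ae (Eventually.of_forall fun s => ?_)
    dsimp only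
    ring
  refine Tendsto.congr' ((eventually_ge_atTop 0).mono fun T hT => (key T hT).symm) ?_
  refine tendsto_integral_filter_of_dominated_convergence (fun x => |g x| * (3 / a)) ?_ ?_ ?_ ?_
  · refine Eventually.of_forall fun T => hg.aestronglyMeasurable.mul ?_
    exact Measurable.aestronglyMeasurable (by fun_prop)
  · filter_upwards [eventually_ge_atTop 0] with T hT
    filter_upwards [ae_restrict_mem measurableSet_Ioi] with x (hx : 0 < x)
    rw [norm_mul, Real.norm_eq_abs, Real.norm_eq_abs]
    refine mul_le_mul_of_nonneg_left ?_ (abs_nonneg _)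
    have hpos : 0 < a ^ 2 + x ^ 2 := by positivity
    rw [abs_div, abs_of_pos hpos, div_le_div_iff₀ hpos ha]
    have he : Real.exp (-x * T) ≤ 1 := Real.exp_le_one_iff.2 (by nlinarith)
    have hb : |a * Real.cos (a * T) + x * Real.sin (a * T)| ≤ a + x := by
      refine (abs_add_le _ _).trans ?_
      rw [abs_mul, abs_mul, abs_of_pos ha, abs_of_pos hx]
      nlinarith [Real.abs_cos_le_one (a * T), Real.abs_sin_le_one (a * T)]
    have h3 : |a - Real.exp (-x * T) * (a * Real.cos (a * T) + x * Real.sin (a * T))| ≤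
        a + (a + x) := by
      refine (abs_sub _ _).trans ?_
      rw [abs_mul, abs_of_pos ha, abs_of_pos (Real.exp_pos _)]
      have := mul_le_mul he hb (abs_nonneg _) zero_le_one
      linarith
    nlinarith [mul_le_mul_of_nonneg_right h3 ha.le, sq_nonneg (a - x)]
  · exact hg.abs.mul_const _
  · filter_upwards [ae_restrict_mem measurableSet_Ioi] with x (hx : 0 < x)
    refine Tendsto.const_mul _ (Tendsto.div_const ?_ _)
    have he : Tendsto (fun T : ℝ => Real.exp (-x * T)) atTop (𝓝 0) :=
      Real.tendsto_exp_atBot.comp (tendsto_id.const_mul_atTop_of_neg (by linarith))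
    have hz : Tendsto (fun T : ℝ => Real.exp (-x * T) *
        (a * Real.cos (a * T) + x * Real.sin (a * T))) atTop (𝓝 0) := by
      refine bdd_le_mul_tendsto_zero' (a + x) ?_ he |>.congr fun T => mul_comm _ _
      refine Eventually.of_forall fun T => (abs_add_le _ _).trans ?_
      rw [abs_mul, abs_mul, abs_of_pos ha, abs_of_pos hx]
      nlinarith [Real.abs_cos_le_one (a * T), Real.abs_sin_le_one (a * T)]
    simpa using tendsto_const_nhds.sub hz

theorem integral_exp_neg_mul_exp_neg_two {s : ℝ} (hs : 0 ≤ s) :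
    ∫ x in Set.Ioi (0 : ℝ), Real.exp (-x * s) * Real.exp (-2 * x) = 1 / (2 + s) := by
  have h := integral_exp_mul_Ioi (a := -(2 + s)) (by linarith) 0
  rw [mul_zero, Real.exp_zero, neg_div_neg_eq] at h
  rw [← h]
  refine integral_congr_ae (Eventually.of_forall fun x => ?_)
  dsimp only
  rw [← Real.exp_add]
  ring_nf

theorem tendsto_integral_sin_div {ν : ℝ} (hν : 0 < ν) :
    Tendsto (fun T : ℝ => ∫ t in (0 : ℝ)..T, Real.sin (ν * t) / (2 + t)) atTop
      (𝓝 (∫ x in Set.Ioi (0 : ℝ), Real.exp (-2 * x) * (ν / (ν ^ 2 + x ^ 2)))) := by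
  refine (tendsto_integral_sin_mul_laplace (g := fun x => Real.exp (-2 * x))
    (integrableOn_exp_mul_Ioi (by norm_num) 0) hν).congr' ?_
  filter_upwards [eventually_ge_atTop 0] with T hT
  refine intervalIntegral.integral_congr fun s hs => ?_
  rw [Set.uIcc_of_le hT] at hs
  rw [integral_exp_neg_mul_exp_neg_two hs.1]
  ring

theorem zeta_eq_laplace_s5 {ν : ℝ} (hν : 0 < ν) :
    zeta ν = Real.pi⁻¹ * ∫ x in Set.Ioi (0 : ℝ), Real.exp (-x * ν) * (2 / (2 ^ 2 + x ^ 2)) := by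
  rw [zeta, (tendsto_integral_sin_div hν).limUnder_eq]
  congr 1
  have h := integral_comp_mul_left_Ioi
    (fun x => Real.exp (-2 * x) * (ν / (ν ^ 2 + x ^ 2))) 0 (half_pos hν)
  rw [mul_zero, smul_eq_mul, eq_inv_mul_iff_mul_eq₀ (half_pos hν).ne'] at h
  rw [← h, ← integral_const_mul]
  refine integral_congr_ae (Eventually.of_forall fun x => ?_)
  dsimp only
  rw [show -2 * (ν / 2 * x) = -x * ν by ring]
  have h1 : (2 : ℝ) ^ 2 + x ^ 2 ≠ 0 := by positivity
  have h2 : ν ^ 2 + (ν / 2 * x) ^ 2 ≠ 0 := by positivity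
  field_simp

theorem zeta_neg (ν : ℝ) : zeta (-ν) = -zeta ν := by
  have hneg : (fun T : ℝ => ∫ t in (0 : ℝ)..T, Real.sin (-ν * t) / (2 + t)) =
      fun T : ℝ => -∫ t in (0 : ℝ)..T, Real.sin (ν * t) / (2 + t) := by
    funext T
    rw [← intervalIntegral.integral_neg]
    simp [neg_div]
  have hlim : ∃ L, Tendsto (fun T : ℝ => ∫ t in (0 : ℝ)..T, Real.sin (ν * t) / (2 + t))
      atTop (𝓝 L) := by
    rcases lt_trichotomy ν 0 with h | rfl | h
    · refine ⟨_, (tendsto_integral_sin_div (neg_pos.2 h)).neg.congr fun T => ?_⟩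
      rw [← intervalIntegral.integral_neg]
      simp [neg_div]
    · exact ⟨0, by simp⟩
    · exact ⟨_, tendsto_integral_sin_div h⟩
  obtain ⟨L, hL⟩ := hlim
  rw [zeta, zeta, hneg, hL.neg.limUnder_eq, hL.limUnder_eq, mul_neg]

theorem integrableOn_div_sq_add_sq {a : ℝ} (ha : 0 < a) :
    IntegrableOn (fun x => a / (a ^ 2 + x ^ 2)) (Set.Ioi 0) := by
  have h := (integrable_inv_one_add_sq.comp_div ha.ne').const_mul (1 / a)
  refine (h.congr (Eventually.of_forall fun x => ?_)).integrableOn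
  dsimp only
  have h1 : a ^ 2 + x ^ 2 ≠ 0 := by positivity
  have h2 : 1 + (x / a) ^ 2 ≠ 0 := by positivity
  field_simp

theorem hasDerivAt_arctan_div {a : ℝ} (ha : 0 < a) (x : ℝ) :
    HasDerivAt (fun x => Real.arctan (x / a)) (a / (a ^ 2 + x ^ 2)) x := by
  convert ((hasDerivAt_id' x).div_const a).arctan using 1
  have h1 : a ^ 2 + x ^ 2 ≠ 0 := by positivity
  have h2 : 1 + (x / a) ^ 2 ≠ 0 := by positivity
  field_simp

theorem tendsto_arctan_div {a : ℝ} (ha : 0 < a) :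
    Tendsto (fun x => Real.arctan (x / a)) atTop (𝓝 (Real.pi / 2)) :=
  (Real.tendsto_arctan_atTop.mono_right nhdsWithin_le_nhds).comp (tendsto_id.atTop_div_const ha)

theorem integral_Ioi_div_sq_add_sq_mul {a b : ℝ} (ha : 0 < a) (hb : 0 < b) :
    ∫ x in Set.Ioi (0 : ℝ), a / (a ^ 2 + x ^ 2) * (b / (b ^ 2 + x ^ 2)) =
      Real.pi / (2 * (a + b)) := by
  have hnonneg : ∀ x ∈ Set.Ioi (0 : ℝ), 0 ≤ a / (a ^ 2 + x ^ 2) * (b / (b ^ 2 + x ^ 2)) :=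
    fun x _ => by positivity
  by_cases hab : a = b
  · subst hab
    have hd : ∀ x ∈ Set.Ici (0 : ℝ), HasDerivAt
        (fun x => (a * (x / (a ^ 2 + x ^ 2)) + Real.arctan (x / a)) / (2 * a))
        (a / (a ^ 2 + x ^ 2) * (a / (a ^ 2 + x ^ 2))) x := by
      intro x _
      have h1 : a ^ 2 + x ^ 2 ≠ 0 := by positivity
      have h2 : HasDerivAt (fun x : ℝ => a ^ 2 + x ^ 2) (2 * x) x := by
        simpa using (hasDerivAt_pow 2 x).const_add (a ^ 2)
      refine (((((hasDerivAt_id' x).div h2 h1).const_mul a).add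
        (hasDerivAt_arctan_div ha x)).div_const (2 * a)).congr_deriv ?_
      field_simp
      ring
    have hz : Tendsto (fun x : ℝ => x / (a ^ 2 + x ^ 2)) atTop (𝓝 0) := by
      refine squeeze_zero' ((eventually_ge_atTop 0).mono fun x hx => by positivity)
        ((eventually_gt_atTop 0).mono fun x hx => ?_) tendsto_inv_atTop_zero
      rw [div_le_iff₀ (by positivity), inv_mul_eq_div, le_div_iff₀ hx]
      nlinarith [sq_nonneg a]
    rw [integral_Ioi_of_hasDerivAt_of_nonneg' hd hnonneg
      (((hz.const_mul a).add (tendsto_arctan_div ha)).div_const (2 * a))]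
    simp
    field_simp
    norm_num
  · have hs : a ^ 2 - b ^ 2 ≠ 0 := by
      rw [sq_sub_sq]
      exact mul_ne_zero (by positivity) (sub_ne_zero.2 hab)
    have hd : ∀ x ∈ Set.Ici (0 : ℝ), HasDerivAt
        (fun x => (a * Real.arctan (x / b) - b * Real.arctan (x / a)) / (a ^ 2 - b ^ 2))
        (a / (a ^ 2 + x ^ 2) * (b / (b ^ 2 + x ^ 2))) x := by
      intro x _
      have h1 : a ^ 2 + x ^ 2 ≠ 0 := by positivity
      have h2 : b ^ 2 + x ^ 2 ≠ 0 := by positivity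
      refine ((((hasDerivAt_arctan_div hb x).const_mul a).sub
        ((hasDerivAt_arctan_div ha x).const_mul b)).div_const (a ^ 2 - b ^ 2)).congr_deriv ?_
      field_simp
      ring
    rw [integral_Ioi_of_hasDerivAt_of_nonneg' hd hnonneg
      ((((tendsto_arctan_div hb).const_mul a).sub
        ((tendsto_arctan_div ha).const_mul b)).div_const (a ^ 2 - b ^ 2))]
    simp
    have h3 : a + b ≠ 0 := by positivity
    field_simp
    ring

theorem tendsto_integral_zeta_mul_sin {t : ℝ} (ht : 0 < t) :
    Tendsto (fun R : ℝ => ∫ ν in (0 : ℝ)..R, zeta ν * Real.sin (ν * t))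
      atTop (𝓝 (1 / (2 * (2 + t)))) := by
  have h := (tendsto_integral_sin_mul_laplace
    (integrableOn_div_sq_add_sq two_pos) ht).const_mul Real.pi⁻¹
  rw [integral_Ioi_div_sq_add_sq_mul two_pos ht, ← mul_div_assoc,
    inv_mul_cancel₀ Real.pi_ne_zero] at h
  refine h.congr' ?_
  filter_upwards [eventually_ge_atTop 0] with R hR
  rw [← intervalIntegral.integral_const_mul, intervalIntegral.integral_of_le hR,
    intervalIntegral.integral_of_le hR]
  refine setIntegral_congr_fun measurableSet_Ioc fun ν hν => ?_
  rw [zeta_eq_laplace_s5 hν.1, mul_comm ν t, mul_assoc]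

theorem intervalIntegrable_zeta (R : ℝ) (hR : 0 ≤ R) : IntervalIntegrable zeta volume 0 R := by
  rw [intervalIntegrable_iff_integrableOn_Ioc_of_le hR]
  refine IntegrableOn.congr_fun (((integrable_prod_exp_neg_mul
    (integrableOn_div_sq_add_sq two_pos) R).integral_prod_left).const_mul Real.pi⁻¹)
    (fun ν hν => ?_) measurableSet_Ioc
  exact (zeta_eq_laplace_s5 hν.1).symm

theorem integral_zeta_mul_cexp (t : ℝ) {R : ℝ} (hR : 0 ≤ R) :
    ∫ ν in (-R)..R, (zeta ν : ℂ) * Complex.exp (-Complex.I * ν * t) =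
      -2 * Complex.I * ((∫ ν in (0 : ℝ)..R, zeta ν * Real.sin (ν * t) : ℝ) : ℂ) := by
  set f : ℝ → ℂ := fun ν => (zeta ν : ℂ) * Complex.exp (-Complex.I * ν * t) with hf
  have hpos : IntervalIntegrable (fun ν => (zeta ν : ℂ)) volume 0 R :=
    ⟨(intervalIntegrable_zeta R hR).1.ofReal, (intervalIntegrable_zeta R hR).2.ofReal⟩
  have hf0 : IntervalIntegrable f volume 0 R := hpos.mul_continuousOn (by fun_prop)
  have hfn : IntervalIntegrable (fun ν => f (-ν)) volume 0 R := by
    have : IntervalIntegrable (fun ν : ℝ => -(zeta ν : ℂ) * Complex.exp (Complex.I * ν * t))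
        volume 0 R := hpos.neg.mul_continuousOn (by fun_prop)
    refine this.congr (fun ν _ => ?_)
    simp [hf, zeta_neg]
  have hf1 : IntervalIntegrable f volume (-R) 0 := by
    simpa using (IntervalIntegrable.comp_sub_left hfn 0).symm
  rw [← intervalIntegral.integral_add_adjacent_intervals hf1 hf0]
  have hn : ∫ ν in (-R)..0, f ν = ∫ ν in (0 : ℝ)..R, f (-ν) := by
    rw [intervalIntegral.integral_comp_neg, neg_zero]
  rw [hn, ← intervalIntegral.integral_add hfn hf0, ← intervalIntegral.integral_ofReal,
    ← intervalIntegral.integral_const_mul]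
  refine intervalIntegral.integral_congr fun ν _ => ?_
  simp only [hf, zeta_neg]
  push_cast
  rw [Complex.sin]
  have e1 : -Complex.I * -(ν : ℂ) * t = ν * t * Complex.I := by ring
  have e2 : -Complex.I * (ν : ℂ) * t = -(ν * t) * Complex.I := by ring
  rw [e1, e2]
  linear_combination ((zeta ν : ℂ) * (Complex.exp (-(ν * t) * Complex.I) -
    Complex.exp (ν * t * Complex.I))) * Complex.I_sq

/-- For `t ≠ 0`, `lim_{R→∞} ∫_{-R}^R ζ(ν) e^{-iνt} dν = −i sgn(t)/(2+|t|)`;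
equivalently, since `ζ` is odd, for `t > 0`, `lim_{R→∞} ∫₀^R ζ(ν) sin(νt) dν = 1/(2(2+t))`. -/
theorem stmt_5 :
    (∀ t : ℝ, t ≠ 0 →
      Tendsto (fun R : ℝ => ∫ ν in (-R)..R, (zeta ν : ℂ) * Complex.exp (-Complex.I * ν * t))
        atTop (nhds (-Complex.I * (Real.sign t : ℂ) / (2 + (|t| : ℝ))))) ∧
    (∀ t : ℝ, 0 < t →
      Tendsto (fun R : ℝ => ∫ ν in (0 : ℝ)..R, zeta ν * Real.sin (ν * t))
        atTop (nhds (1 / (2 * (2 + t))))) := by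
  refine ⟨fun t ht => ?_, fun t ht => tendsto_integral_zeta_mul_sin ht⟩
  have hsin : Tendsto (fun R : ℝ => ∫ ν in (0 : ℝ)..R, zeta ν * Real.sin (ν * t))
      atTop (𝓝 (Real.sign t * (1 / (2 * (2 + |t|))))) := by
    refine ((tendsto_integral_zeta_mul_sin (abs_pos.2 ht)).const_mul (Real.sign t)).congr
      fun R => ?_
    rw [← intervalIntegral.integral_const_mul]
    refine intervalIntegral.integral_congr fun ν _ => ?_
    rcases ht.lt_or_gt with h | h
    · simp [Real.sign_of_neg h, abs_of_neg h]
    · simp [Real.sign_of_pos h, abs_of_pos h]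
  have hc := ((Complex.continuous_ofReal.tendsto _).comp hsin).const_mul (-2 * Complex.I)
  have hval : -2 * Complex.I * ((Real.sign t * (1 / (2 * (2 + |t|))) : ℝ) : ℂ) =
      -Complex.I * (Real.sign t : ℂ) / (2 + (|t| : ℝ)) := by
    have hne : (2 + (|t| : ℝ) : ℂ) ≠ 0 := by
      exact_mod_cast (by positivity : (2 + |t| : ℝ) ≠ 0)
    push_cast
    field_simp
  rw [hval] at hc
  refine hc.congr' ?_
  filter_upwards [eventually_ge_atTop 0] with R hR
  exact (integral_zeta_mul_cexp t hR).symm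
end

section
/- The formula (M u)(t) = π^{-1} ∫₀^∞ (2 + t + s)^{-1} u(s) ds defines a bounded self-adjoint operator M (the Mehler operator) on the complex Hilbert space L²(0,∞), and there exists a unitary operator Ψ : L²(0,∞) → L²(0,∞) such that (Ψ M u)(τ) = (cosh(πτ))^{-1} (Ψ u)(τ) for almost every τ > 0 and every u ∈ L²(0,∞). Consequently the spectrum of M equals the interval [0,1] and M has no eigenvalues. -/
open MeasureTheory

noncomputable section

/-- Lebesgue measure on the half-line `(0,∞)`. -/
abbrev muPlus : Measure ℝ := volume.restrict (Set.Ioi (0 : ℝ))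

/-- The complex Hilbert space `L²(0,∞)`. -/
abbrev L2plus := Lp ℂ 2 muPlus

section SchurTest

open scoped ENNReal

variable {α β : Type*} [MeasurableSpace α] [MeasurableSpace β] {μ : Measure α} {ν : Measure β}

/-- The Schur test with weights, for nonnegative functions. -/
lemma lintegral_sq_lintegral_le [SFinite μ] [SFinite ν] {κ : α → β → ℝ≥0∞}
    (hκ : Measurable (Function.uncurry κ)) {p : β → ℝ≥0∞} {q : α → ℝ≥0∞} (hp : Measurable p)
    (hq : Measurable q) (hp0 : ∀ y, p y ≠ 0) (hpt : ∀ y, p y ≠ ∞) {C D : ℝ≥0∞}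
    (h₁ : ∀ᵐ x ∂μ, ∫⁻ y, κ x y * p y ∂ν ≤ C * q x)
    (h₂ : ∀ᵐ y ∂ν, ∫⁻ x, κ x y * q x ∂μ ≤ D * p y) {f : β → ℝ≥0∞} (hf : AEMeasurable f ν) :
    ∫⁻ x, (∫⁻ y, κ x y * f y ∂ν) ^ (2 : ℝ) ∂μ ≤ C * D * ∫⁻ y, f y ^ (2 : ℝ) ∂ν := by
  have hκx (x : α) : Measurable (κ x) := hκ.of_uncurry_left
  have key : ∀ᵐ x ∂μ, (∫⁻ y, κ x y * f y ∂ν) ^ (2 : ℝ) ≤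
      C * q x * ∫⁻ y, κ x y * (f y ^ (2 : ℝ) / p y) ∂ν := by
    filter_upwards [h₁] with x hx
    refine le_trans ?_ (mul_le_mul_left hx _)
    have hsplit : ∀ y, κ x y * f y =
        ((fun y => (κ x y * p y) ^ (1 / 2 : ℝ)) *
          fun y => (κ x y * (f y ^ (2 : ℝ) / p y)) ^ (1 / 2 : ℝ)) y := by
      intro y
      simp only [Pi.mul_apply]
      rw [← ENNReal.mul_rpow_of_nonneg _ _ (by norm_num)]
      have : κ x y * p y * (κ x y * (f y ^ (2 : ℝ) / p y)) = (κ x y * f y) ^ (2 : ℝ) := by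
        rw [ENNReal.mul_rpow_of_nonneg _ _ (by norm_num), mul_mul_mul_comm,
          ENNReal.mul_div_cancel (hp0 y) (hpt y)]
        congr 1
        rw [ENNReal.rpow_two, sq]
      rw [this, ← ENNReal.rpow_mul]
      norm_num
    have hm1 : AEMeasurable (fun y => (κ x y * p y) ^ (1 / 2 : ℝ)) ν :=
      (((hκx x).mul hp).pow_const _).aemeasurable
    have hm2 : AEMeasurable (fun y => (κ x y * (f y ^ (2 : ℝ) / p y)) ^ (1 / 2 : ℝ)) ν :=
      ((hκx x).aemeasurable.mul ((hf.pow_const _).div hp.aemeasurable)).pow_const _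
    calc (∫⁻ y, κ x y * f y ∂ν) ^ (2 : ℝ)
        ≤ ((∫⁻ y, κ x y * p y ∂ν) ^ (1 / 2 : ℝ) *
            (∫⁻ y, κ x y * (f y ^ (2 : ℝ) / p y) ∂ν) ^ (1 / 2 : ℝ)) ^ (2 : ℝ) := by
          refine ENNReal.rpow_le_rpow ?_ (by norm_num)
          have := ENNReal.lintegral_mul_le_Lp_mul_Lq ν Real.HolderConjugate.two_two hm1 hm2
          simp only [← hsplit, ← ENNReal.rpow_mul] at this
          norm_num at this
          simpa using this
      _ = _ := by
          rw [ENNReal.mul_rpow_of_nonneg _ _ (by norm_num), ← ENNReal.rpow_mul,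
            ← ENNReal.rpow_mul]
          norm_num
  calc ∫⁻ x, (∫⁻ y, κ x y * f y ∂ν) ^ (2 : ℝ) ∂μ
      ≤ ∫⁻ x, ∫⁻ y, C * q x * (κ x y * (f y ^ (2 : ℝ) / p y)) ∂ν ∂μ := by
        refine lintegral_mono_ae ?_
        filter_upwards [key] with x hx
        refine hx.trans_eq (lintegral_const_mul'' _ ?_).symm
        exact (hκx x).aemeasurable.mul ((hf.pow_const _).div hp.aemeasurable)
    _ = ∫⁻ y, ∫⁻ x, C * q x * (κ x y * (f y ^ (2 : ℝ) / p y)) ∂μ ∂ν := by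
        refine lintegral_lintegral_swap ?_
        refine AEMeasurable.mul (by fun_prop) (hκ.aemeasurable.mul ?_)
        exact (((hf.pow_const _).div hp.aemeasurable)).comp_snd
    _ ≤ ∫⁻ y, C * D * f y ^ (2 : ℝ) ∂ν := by
        refine lintegral_mono_ae ?_
        filter_upwards [h₂] with y hy
        have hκy : Measurable fun x => κ x y := hκ.of_uncurry_right
        calc ∫⁻ x, C * q x * (κ x y * (f y ^ (2 : ℝ) / p y)) ∂μ
            = ∫⁻ x, C * (f y ^ (2 : ℝ) / p y) * (κ x y * q x) ∂μ := by
              congr 1; ext x; ring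
          _ = C * (f y ^ (2 : ℝ) / p y) * ∫⁻ x, κ x y * q x ∂μ :=
              lintegral_const_mul _ (hκy.mul hq)
          _ ≤ C * (f y ^ (2 : ℝ) / p y) * (D * p y) := by gcongr
          _ = C * D * (p y * (f y ^ (2 : ℝ) / p y)) := by ring
          _ = C * D * f y ^ (2 : ℝ) := by
              rw [ENNReal.mul_div_cancel (hp0 y) (hpt y)]
    _ = _ := lintegral_const_mul'' _ (hf.pow_const _)

/-- Under the hypotheses of the Schur test, a real kernel defines a bounded operator between
`L²` spaces. -/
theorem exists_integralOperator [SFinite μ] [SFinite ν] {k : α → β → ℝ}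
    (hk : Measurable (Function.uncurry k)) {p : β → ℝ≥0∞} {q : α → ℝ≥0∞} (hp : Measurable p)
    (hq : Measurable q) (hp0 : ∀ y, p y ≠ 0) (hpt : ∀ y, p y ≠ ∞) {C D : ℝ≥0∞}
    (hC : C ≠ ∞) (hD : D ≠ ∞)
    (h₁ : ∀ᵐ x ∂μ, ∫⁻ y, ‖k x y‖ₑ * p y ∂ν ≤ C * q x)
    (h₂ : ∀ᵐ y ∂ν, ∫⁻ x, ‖k x y‖ₑ * q x ∂μ ≤ D * p y) :
    ∃ K : Lp ℂ 2 ν →L[ℂ] Lp ℂ 2 μ, ∀ u : Lp ℂ 2 ν,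
      (∀ᵐ x ∂μ, Integrable (fun y => (k x y : ℂ) * u y) ν) ∧
      (∀ᵐ x ∂μ, K u x = ∫ y, (k x y : ℂ) * u y ∂ν) ∧
      ∀ v : Lp ℂ 2 μ,
        Integrable (fun z : α × β => (k z.1 z.2 : ℂ) * u z.2 * star (v z.1)) (μ.prod ν) := by
  have hκ : Measurable (Function.uncurry fun x y => ‖k x y‖ₑ) := hk.enorm
  have henorm (r : ℝ) : ‖(r : ℂ)‖ₑ = ‖r‖ₑ := by
    rw [← ofReal_norm, ← ofReal_norm, Complex.norm_real]
  have hum (u : Lp ℂ 2 ν) : AEStronglyMeasurable u ν := Lp.aestronglyMeasurable u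
  have hjm (u : Lp ℂ 2 ν) :
      AEStronglyMeasurable (fun z : α × β => (k z.1 z.2 : ℂ) * u z.2) (μ.prod ν) :=
    (Complex.continuous_ofReal.comp_aestronglyMeasurable hk.aestronglyMeasurable).mul
      (hum u).comp_snd
  have hL2 (u : Lp ℂ 2 ν) : ∫⁻ y, ‖u y‖ₑ ^ (2 : ℝ) ∂ν = ‖u‖ₑ ^ (2 : ℝ) := by
    rw [Lp.enorm_def, eLpNorm_eq_lintegral_rpow_enorm_toReal (by norm_num) (by norm_num),
      ← ENNReal.rpow_mul]
    norm_num
  have hS (u : Lp ℂ 2 ν) : ∫⁻ x, (∫⁻ y, ‖k x y‖ₑ * ‖u y‖ₑ ∂ν) ^ (2 : ℝ) ∂μ ≤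
      C * D * ‖u‖ₑ ^ (2 : ℝ) := by
    rw [← hL2]
    exact lintegral_sq_lintegral_le hκ hp hq hp0 hpt h₁ h₂ (hum u).enorm
  have hfin (u : Lp ℂ 2 ν) : C * D * ‖u‖ₑ ^ (2 : ℝ) ≠ ∞ :=
    ENNReal.mul_ne_top (ENNReal.mul_ne_top hC hD)
      (ENNReal.rpow_ne_top_of_nonneg (by norm_num) enorm_ne_top)
  have hmeas (u : Lp ℂ 2 ν) : AEMeasurable (fun x => ∫⁻ y, ‖k x y‖ₑ * ‖u y‖ₑ ∂ν) μ :=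
    AEMeasurable.lintegral_prod_right (hκ.aemeasurable.mul (hum u).enorm.comp_snd)
  have hkint (u : Lp ℂ 2 ν) : ∀ᵐ x ∂μ, Integrable (fun y => (k x y : ℂ) * u y) ν := by
    have := ae_lt_top' ((hmeas u).pow_const (2 : ℝ)) (ne_top_of_le_ne_top (hfin u) (hS u))
    filter_upwards [this] with x hx
    refine ⟨(Complex.continuous_ofReal.comp_aestronglyMeasurable
      hk.of_uncurry_left.aestronglyMeasurable).mul (hum u), ?_⟩
    have h := (ENNReal.rpow_lt_top_iff_of_pos (by norm_num)).1 hx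
    simpa [HasFiniteIntegral, enorm_mul, henorm] using h
  have hle (u : Lp ℂ 2 ν) (x : α) :
      ‖∫ y, (k x y : ℂ) * u y ∂ν‖ₑ ≤ ∫⁻ y, ‖k x y‖ₑ * ‖u y‖ₑ ∂ν := by
    refine (enorm_integral_le_lintegral_enorm _).trans_eq ?_
    simp [enorm_mul, henorm]
  have hnorm (u : Lp ℂ 2 ν) : eLpNorm (fun x => ∫ y, (k x y : ℂ) * u y ∂ν) 2 μ ≤
      (C * D) ^ (1 / 2 : ℝ) * ‖u‖ₑ := by
    rw [eLpNorm_eq_lintegral_rpow_enorm_toReal (by norm_num) (by norm_num)]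
    calc _ ≤ (C * D * ‖u‖ₑ ^ (2 : ℝ)) ^ (1 / 2 : ℝ) := by
          simp only [ENNReal.toReal_ofNat]
          refine ENNReal.rpow_le_rpow (le_trans (lintegral_mono fun x => ?_) (hS u)) (by norm_num)
          exact ENNReal.rpow_le_rpow (hle u x) (by norm_num)
      _ = _ := by
          rw [ENNReal.mul_rpow_of_nonneg _ _ (by norm_num), ← ENNReal.rpow_mul]
          norm_num
  have hcfin : (C * D) ^ (1 / 2 : ℝ) ≠ ∞ :=
    ENNReal.rpow_ne_top_of_nonneg (by norm_num) (ENNReal.mul_ne_top hC hD)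
  have hmem (u : Lp ℂ 2 ν) : MemLp (fun x => ∫ y, (k x y : ℂ) * u y ∂ν) 2 μ :=
    ⟨(hjm u).integral_prod_right',
      (hnorm u).trans_lt (ENNReal.mul_ne_top hcfin enorm_ne_top).lt_top⟩
  let K₀ : Lp ℂ 2 ν →ₗ[ℂ] Lp ℂ 2 μ :=
    { toFun := fun u => (hmem u).toLp
      map_add' := by
        intro u v
        refine Lp.ext ?_
        filter_upwards [(hmem (u + v)).coeFn_toLp, (hmem u).coeFn_toLp, (hmem v).coeFn_toLp,
          Lp.coeFn_add (hmem u).toLp (hmem v).toLp, hkint u, hkint v] with x h1 h2 h3 h4 h5 h6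
        rw [h1, h4, Pi.add_apply, h2, h3, ← integral_add h5 h6]
        refine integral_congr_ae ?_
        filter_upwards [Lp.coeFn_add u v] with y hy
        rw [hy, Pi.add_apply, mul_add]
      map_smul' := by
        intro c u
        refine Lp.ext ?_
        filter_upwards [(hmem (c • u)).coeFn_toLp, (hmem u).coeFn_toLp,
          Lp.coeFn_smul c (hmem u).toLp] with x h1 h2 h3
        rw [h1, RingHom.id_apply, h3, Pi.smul_apply, h2, smul_eq_mul, ← integral_const_mul]
        refine integral_congr_ae ?_
        filter_upwards [Lp.coeFn_smul c u] with y hy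
        rw [hy, Pi.smul_apply, smul_eq_mul]
        ring }
  refine ⟨K₀.mkContinuous ((C * D) ^ (1 / 2 : ℝ)).toReal fun u => ?_, fun u => ⟨hkint u, ?_, ?_⟩⟩
  · have h : ‖K₀ u‖ₑ ≤ (C * D) ^ (1 / 2 : ℝ) * ‖u‖ₑ := by
      refine le_trans (le_of_eq ?_) (hnorm u)
      exact Lp.enorm_toLp (hf := hmem u)
    have := ENNReal.toReal_mono (ENNReal.mul_ne_top hcfin enorm_ne_top) h
    simpa using this
  · exact (hmem u).coeFn_toLp
  · intro v
    have hvm := Lp.aestronglyMeasurable v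
    have hm : AEStronglyMeasurable
        (fun z : α × β => (k z.1 z.2 : ℂ) * u z.2 * star (v z.1)) (μ.prod ν) :=
      (hjm u).mul (continuous_star.comp_aestronglyMeasurable hvm.comp_fst)
    refine ⟨hm, ?_⟩
    have h2 : ∫⁻ x, ∫⁻ y, ‖k x y‖ₑ * ‖u y‖ₑ * ‖v x‖ₑ ∂ν ∂μ < ∞ := by
      have hv2 : ∫⁻ x, ‖v x‖ₑ ^ (2 : ℝ) ∂μ < ∞ := by
        simpa using lintegral_rpow_enorm_lt_top_of_eLpNorm_lt_top (p := 2) (by norm_num)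
          (by norm_num) (Lp.memLp v).2
      calc ∫⁻ x, ∫⁻ y, ‖k x y‖ₑ * ‖u y‖ₑ * ‖v x‖ₑ ∂ν ∂μ
          = ∫⁻ x, ((fun x => ∫⁻ y, ‖k x y‖ₑ * ‖u y‖ₑ ∂ν) * fun x => ‖v x‖ₑ) x ∂μ := by
            refine lintegral_congr fun x => ?_
            exact lintegral_mul_const' _ _ enorm_ne_top
        _ ≤ _ := ENNReal.lintegral_mul_le_Lp_mul_Lq μ Real.HolderConjugate.two_two (hmeas u)
            hvm.enorm
        _ < ∞ := ENNReal.mul_lt_top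
            (ENNReal.rpow_lt_top_of_nonneg (by norm_num) (ne_top_of_le_ne_top (hfin u) (hS u)))
            (ENNReal.rpow_lt_top_of_nonneg (by norm_num) hv2.ne)
    rw [HasFiniteIntegral, lintegral_prod _ hm.enorm]
    simpa [enorm_mul, henorm] using h2

end SchurTest

section Abstract

open scoped InnerProductSpace

/-- An injective operator with dense range that intertwines two self-adjoint operators gives rise,
by polar decomposition, to a unitary operator intertwining them. -/
theorem exists_unitary_of_intertwining {H : Type*} [NormedAddCommGroup H] [InnerProductSpace ℂ H]
    [CompleteSpace H] {W M S : H →L[ℂ] H} (hM : IsSelfAdjoint M) (hS : IsSelfAdjoint S)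
    (hW : W * M = S * W) (hinj : ∀ u, W u = 0 → u = 0)
    (hdense : ∀ v, (∀ u, ⟪W u, v⟫_ℂ = 0) → v = 0) :
    ∃ U : H ≃ₗᵢ[ℂ] H, ∀ u, U (M u) = S (U u) := by
  have denseRange_of (A : H →L[ℂ] H) (hA : ∀ v, (∀ u, ⟪A u, v⟫_ℂ = 0) → v = 0) :
      DenseRange A := by
    have : A.range.topologicalClosure = ⊤ := by
      rw [Submodule.topologicalClosure_eq_top_iff, Submodule.eq_bot_iff]
      intro v hv
      exact hA v fun u => (Submodule.mem_orthogonal _ _).1 hv _ ⟨u, rfl⟩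
    rw [DenseRange, dense_iff_closure_eq]
    exact congrArg (fun s : Submodule ℂ H => (s : Set H)) this
  set P : H →L[ℂ] H := CFC.abs W with hP
  have hPsa : IsSelfAdjoint P := (CFC.abs_nonneg W).isSelfAdjoint
  have hPP : P * P = star W * W := CFC.abs_mul_abs W
  have hnorm (u : H) : ‖W u‖ = ‖P u‖ := by
    have h1 : ⟪P u, P u⟫_ℂ = ⟪W u, W u⟫_ℂ := by
      rw [← ContinuousLinearMap.adjoint_inner_right P, ← ContinuousLinearMap.adjoint_inner_right W,
        ← ContinuousLinearMap.star_eq_adjoint, ← ContinuousLinearMap.star_eq_adjoint,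
        hPsa.star_eq, ← mul_apply_eq_comp, hPP, mul_apply_eq_comp]
    rw [inner_self_eq_norm_sq_to_K, inner_self_eq_norm_sq_to_K] at h1
    have h2 : ‖P u‖ ^ 2 = ‖W u‖ ^ 2 := by exact_mod_cast h1
    exact ((sq_eq_sq₀ (norm_nonneg _) (norm_nonneg _)).1 h2).symm
  have hcomm : Commute P M := by
    have hWM : star W * S = M * star W := by
      have := congrArg star hW
      rwa [star_mul, star_mul, hM.star_eq, hS.star_eq, eq_comm] at this
    have h1 : Commute (star W * W) M := by
      rw [Commute, SemiconjBy, mul_assoc, hW, ← mul_assoc, hWM, mul_assoc]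
    rw [hP, CFC.abs, CFC.sqrt_eq_real_sqrt _ (star_mul_self_nonneg W)]
    exact h1.cfcₙ_real _
  have hPdense : DenseRange P := by
    refine denseRange_of P fun v hv => hinj v ?_
    have hPv : P v = 0 := by
      refine ext_inner_left ℂ fun u => ?_
      rw [inner_zero_right, ← hv u, ← ContinuousLinearMap.adjoint_inner_right P,
        ← ContinuousLinearMap.star_eq_adjoint, hPsa.star_eq]
    rw [← norm_eq_zero, hnorm, hPv, norm_zero]
  let U : H ≃ₗᵢ[ℂ] H := (LinearEquiv.refl ℂ H).extendOfIsometry (P : H →ₗ[ℂ] H) (W : H →ₗ[ℂ] H)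
    hPdense (denseRange_of W hdense) hnorm
  have hU (u : H) : U (P u) = W u :=
    (LinearEquiv.refl ℂ H).extendOfIsometry_eq (P : H →ₗ[ℂ] H) (W : H →ₗ[ℂ] H)
      hPdense (denseRange_of W hdense) hnorm u
  refine ⟨U, fun u => ?_⟩
  refine hPdense.induction_on (p := fun u => U (M u) = S (U u)) u
    (isClosed_eq (by fun_prop) (by fun_prop)) fun u => ?_
  have h1 : M (P u) = P (M u) := (DFunLike.congr_fun hcomm.eq u).symm
  have h2 : W (M u) = S (W u) := DFunLike.congr_fun hW u
  rw [h1, hU, hU, h2]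

variable {α β : Type*} [MeasurableSpace α] [MeasurableSpace β] {μ : Measure α} {ν : Measure β}

/-- Bounded measurable functions act on `L²` by multiplication. -/
theorem exists_mulOperator {f : α → ℂ} (hf : Measurable f) {C : ℝ} (hC : ∀ᵐ x ∂μ, ‖f x‖ ≤ C) :
    ∃ T : Lp ℂ 2 μ →L[ℂ] Lp ℂ 2 μ, ∀ u : Lp ℂ 2 μ, ∀ᵐ x ∂μ, T u x = f x * u x := by
  have hm : MemLp f ⊤ μ := memLp_top_of_bound hf.aestronglyMeasurable C hC
  refine ⟨(ContinuousLinearMap.mul ℂ ℂ).holderL μ ⊤ 2 2 hm.toLp, fun u => ?_⟩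
  filter_upwards [(ContinuousLinearMap.mul ℂ ℂ).coeFn_holder (r := 2) hm.toLp u,
    hm.coeFn_toLp] with x h1 h2
  rw [← h2]
  exact h1

lemma isSelfAdjoint_of_mul_real {T : Lp ℂ 2 μ →L[ℂ] Lp ℂ 2 μ} {f : α → ℝ}
    (hT : ∀ u : Lp ℂ 2 μ, ∀ᵐ x ∂μ, T u x = (f x : ℂ) * u x) : IsSelfAdjoint T := by
  rw [ContinuousLinearMap.isSelfAdjoint_iff_isSymmetric]
  intro u v
  simp only [ContinuousLinearMap.coe_coe]
  rw [L2.inner_def, L2.inner_def]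
  refine integral_congr_ae ?_
  filter_upwards [hT u, hT v] with x hu hv
  simp [hu, hv]
  ring

/-- Integral operators with transposed real kernels are adjoint to each other. -/
lemma inner_integralOperator [SFinite μ] [SFinite ν] {k : α → β → ℝ}
    {u : Lp ℂ 2 ν} {v : Lp ℂ 2 μ} {a : Lp ℂ 2 μ} {b : Lp ℂ 2 ν}
    (ha : ∀ᵐ x ∂μ, a x = ∫ y, (k x y : ℂ) * u y ∂ν)
    (hb : ∀ᵐ y ∂ν, b y = ∫ x, (k x y : ℂ) * v x ∂μ)
    (hkint : Integrable (fun z : α × β => (k z.1 z.2 : ℂ) * u z.2 * star (v z.1)) (μ.prod ν)) :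
    ⟪v, a⟫_ℂ = ⟪b, u⟫_ℂ := by
  rw [L2.inner_def, L2.inner_def]
  calc ∫ x, ⟪v x, a x⟫_ℂ ∂μ = ∫ x, ∫ y, (k x y : ℂ) * u y * star (v x) ∂ν ∂μ := by
        refine integral_congr_ae ?_
        filter_upwards [ha] with x hx
        rw [integral_mul_const, ← hx]
        simp
    _ = ∫ y, ∫ x, (k x y : ℂ) * u y * star (v x) ∂μ ∂ν := integral_integral_swap hkint
    _ = ∫ y, ⟪b y, u y⟫_ℂ ∂ν := by
        refine integral_congr_ae ?_
        filter_upwards [hb] with y hy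
        rw [hy, RCLike.inner_apply, ← integral_conj, ← integral_const_mul]
        refine integral_congr_ae (Filter.Eventually.of_forall fun x => ?_)
        simp
        ring

end Abstract

section Spectrum

/-- The operator of multiplication by `f` on `L²` has no spectrum away from a closed set containing
the essential range. -/
lemma spectrum_subset_of_mul {α : Type*} [MeasurableSpace α] {μ : Measure α}
    {T : Lp ℂ 2 μ →L[ℂ] Lp ℂ 2 μ} {f : α → ℂ} (hf : Measurable f)
    (hT : ∀ u : Lp ℂ 2 μ, ∀ᵐ x ∂μ, T u x = f x * u x) {s : Set ℂ} (hs : IsClosed s)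
    (hfs : ∀ᵐ x ∂μ, f x ∈ s) : spectrum ℂ T ⊆ s := by
  intro z hz
  by_contra hzs
  obtain ⟨δ, hδ, hball⟩ := Metric.isOpen_iff.1 hs.isOpen_compl z hzs
  have hfar : ∀ᵐ x ∂μ, δ ≤ ‖z - f x‖ := by
    filter_upwards [hfs] with x hx
    by_contra! h
    exact hball (by rwa [Metric.mem_ball, dist_comm, dist_eq_norm]) hx
  obtain ⟨R, hR⟩ := exists_mulOperator (μ := μ) (f := fun x => (z - f x)⁻¹) (C := δ⁻¹)
    ((measurable_const.sub hf).inv) (by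
      filter_upwards [hfar] with x hx
      rw [norm_inv]
      gcongr)
  refine hz ?_
  rw [spectrum.mem_resolventSet_iff, isUnit_iff_exists]
  have hT' (u : Lp ℂ 2 μ) : ∀ᵐ x ∂μ, ((algebraMap ℂ (Lp ℂ 2 μ →L[ℂ] Lp ℂ 2 μ) z - T) u) x =
      (z - f x) * u x := by
    have h0 : (algebraMap ℂ (Lp ℂ 2 μ →L[ℂ] Lp ℂ 2 μ) z - T) u = z • u - T u := by
      simp [Algebra.algebraMap_eq_smul_one]
    rw [h0]
    filter_upwards [hT u, Lp.coeFn_sub (z • u) (T u), Lp.coeFn_smul z u] with x h1 h2 h3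
    rw [h2, Pi.sub_apply, h3, h1, Pi.smul_apply, smul_eq_mul]
    ring
  refine ⟨R, ?_, ?_⟩
  · ext1 u
    refine Lp.ext ?_
    filter_upwards [hT' (R u), hR u, hfar] with x h1 h2 h3
    have h4 : z - f x ≠ 0 := norm_pos_iff.1 (hδ.trans_le h3)
    simp only [mul_apply_eq_comp, one_apply_eq_self]
    rw [h1, h2, mul_inv_cancel_left₀ h4]
  · ext1 u
    refine Lp.ext ?_
    filter_upwards [hT' u, hR ((algebraMap ℂ (Lp ℂ 2 μ →L[ℂ] Lp ℂ 2 μ) z - T) u), hfar]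
      with x h1 h2 h3
    have h4 : z - f x ≠ 0 := norm_pos_iff.1 (hδ.trans_le h3)
    simp only [mul_apply_eq_comp, one_apply_eq_self]
    rw [h2, h1, inv_mul_cancel_left₀ h4]

/-- Values of a continuous function on the open half-line belong to the spectrum of the
corresponding multiplication operator. -/
lemma mem_spectrum_of_mul {T : L2plus →L[ℂ] L2plus} {f : ℝ → ℂ} (hf : Continuous f)
    (hT : ∀ u : L2plus, ∀ᵐ x ∂muPlus, T u x = f x * u x) {a : ℝ} (ha : 0 < a) :
    f a ∈ spectrum ℂ T := by
  intro hunit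
  obtain ⟨R, -, hR⟩ := isUnit_iff_exists.1 hunit
  set ε : ℝ := (‖R‖ + 1)⁻¹ with hε
  have hR1 : 0 < ‖R‖ + 1 := by positivity
  have hεpos : 0 < ε := by positivity
  obtain ⟨δ, hδ, hcont⟩ := Metric.continuous_iff.1 hf a ε hεpos
  set s : Set ℝ := Set.Ioo a (a + δ) with hs
  have hs_sub : s ⊆ Set.Ioi 0 := fun x hx => ha.trans hx.1
  have hsμ : muPlus s = ENNReal.ofReal δ := by
    rw [Measure.restrict_apply measurableSet_Ioo, Set.inter_eq_left.2 hs_sub, Real.volume_Ioo]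
    simp
  have hsfin : muPlus s ≠ ⊤ := by simp [hsμ]
  set u : L2plus := indicatorConstLp 2 measurableSet_Ioo hsfin (1 : ℂ) with hu
  have hupos : 0 < ‖u‖ := by
    rw [hu, norm_indicatorConstLp (by norm_num) (by norm_num), norm_one, one_mul]
    refine Real.rpow_pos_of_pos ?_ _
    rw [measureReal_def, hsμ, ENNReal.toReal_ofReal hδ.le]
    exact hδ
  have hle : ‖(algebraMap ℂ (L2plus →L[ℂ] L2plus) (f a) - T) u‖ ≤ ε * ‖u‖ := by
    have h0 : (algebraMap ℂ (L2plus →L[ℂ] L2plus) (f a) - T) u = f a • u - T u := by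
      simp [Algebra.algebraMap_eq_smul_one]
    rw [h0]
    refine Lp.norm_le_mul_norm_of_ae_le_mul ?_
    filter_upwards [hT u, Lp.coeFn_sub (f a • u) (T u), Lp.coeFn_smul (f a) u,
      indicatorConstLp_coeFn (p := 2) (hs := measurableSet_Ioo) (hμs := hsfin) (c := (1 : ℂ))]
      with x h1 h2 h3 h4
    rw [h2, Pi.sub_apply, h3, h1, Pi.smul_apply, smul_eq_mul, ← sub_mul, norm_mul]
    by_cases hx : x ∈ s
    · gcongr
      rw [← dist_eq_norm, dist_comm]
      refine (hcont x ?_).le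
      rw [Real.dist_eq, abs_lt]
      constructor <;> linarith [hx.1, hx.2]
    · have : (u : ℝ → ℂ) x = 0 := by
        rw [hu, h4, Set.indicator_of_notMem hx]
      simp [this]
  have h1 : u = R ((algebraMap ℂ (L2plus →L[ℂ] L2plus) (f a) - T) u) := by
    rw [← mul_apply_eq_comp, hR, one_apply_eq_self]
  have h2 : ‖u‖ ≤ ‖R‖ * (ε * ‖u‖) := by
    conv_lhs => rw [h1]
    exact (R.le_opNorm _).trans (by gcongr)
  have h3 : ‖R‖ * ε < 1 := by
    rw [hε, ← div_eq_mul_inv, div_lt_one hR1]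
    linarith
  nlinarith

lemma continuous_sech : Continuous fun τ : ℝ => (Real.cosh (Real.pi * τ))⁻¹ :=
  (Real.continuous_cosh.comp (continuous_const.mul continuous_id)).inv₀
    fun _ => (Real.cosh_pos _).ne'

lemma sech_mem_Icc (τ : ℝ) : (Real.cosh (Real.pi * τ))⁻¹ ∈ Set.Icc (0 : ℝ) 1 :=
  ⟨inv_nonneg.2 (Real.cosh_pos _).le, inv_le_one_of_one_le₀ (Real.one_le_cosh _)⟩

lemma spectrum_mul_sech {T : L2plus →L[ℂ] L2plus}
    (hT : ∀ u : L2plus, ∀ᵐ τ ∂muPlus,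
      T u τ = (((Real.cosh (Real.pi * τ))⁻¹ : ℝ) : ℂ) * u τ) :
    spectrum ℂ T = Complex.ofReal '' Set.Icc (0 : ℝ) 1 := by
  have hc : Continuous fun τ : ℝ => (((Real.cosh (Real.pi * τ))⁻¹ : ℝ) : ℂ) :=
    Complex.continuous_ofReal.comp continuous_sech
  refine Set.Subset.antisymm ?_ ?_
  · refine spectrum_subset_of_mul hc.measurable hT
      (isCompact_Icc.image Complex.continuous_ofReal).isClosed ?_
    exact Filter.Eventually.of_forall fun τ => ⟨_, sech_mem_Icc τ, rfl⟩
  · have h1 : Complex.ofReal '' Set.Ioo (0 : ℝ) 1 ⊆ spectrum ℂ T := by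
      rintro _ ⟨r, hr, rfl⟩
      have h1r : 1 < r⁻¹ := (one_lt_inv₀ hr.1).2 hr.2
      have := mem_spectrum_of_mul hc hT (a := Real.arcosh r⁻¹ / Real.pi)
        (div_pos (Real.arcosh_pos h1r) Real.pi_pos)
      rwa [mul_div_cancel₀ _ Real.pi_ne_zero, Real.cosh_arcosh h1r.le, inv_inv] at this
    rw [← closure_Ioo (zero_ne_one' ℝ)]
    exact (image_closure_subset_closure_image Complex.continuous_ofReal).trans
      (closure_minimal h1 (spectrum.isClosed T))

lemma eq_zero_of_mul_sech_eq {T : L2plus →L[ℂ] L2plus}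
    (hT : ∀ u : L2plus, ∀ᵐ τ ∂muPlus,
      T u τ = (((Real.cosh (Real.pi * τ))⁻¹ : ℝ) : ℂ) * u τ) {c : ℂ} {u : L2plus}
    (hu : T u = c • u) : u = 0 := by
  have hnull : ∀ᵐ τ ∂muPlus, (((Real.cosh (Real.pi * τ))⁻¹ : ℝ) : ℂ) ≠ c := by
    rw [ae_restrict_iff' measurableSet_Ioi]
    have hsub : Set.Subsingleton
        {τ : ℝ | 0 < τ ∧ (((Real.cosh (Real.pi * τ))⁻¹ : ℝ) : ℂ) = c} := by
      rintro x ⟨hx, hxc⟩ y ⟨hy, hyc⟩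
      have h1 : (Real.cosh (Real.pi * x))⁻¹ = (Real.cosh (Real.pi * y))⁻¹ := by
        exact_mod_cast hxc.trans hyc.symm
      have h2 := Real.cosh_injOn (mul_pos Real.pi_pos hx).le (mul_pos Real.pi_pos hy).le
        (inv_injective h1)
      exact mul_left_cancel₀ Real.pi_ne_zero h2
    refine measure_mono_null (fun τ hτ => ?_) (hsub.measure_zero volume)
    simpa using hτ
  refine Lp.ext ?_
  filter_upwards [hT u, hnull, Lp.coeFn_smul c u, Lp.coeFn_zero ℂ 2 muPlus] with τ h1 h2 h3 h4
  rw [hu, h3, Pi.smul_apply, smul_eq_mul] at h1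
  rw [h4, Pi.zero_apply]
  have : ((((Real.cosh (Real.pi * τ))⁻¹ : ℝ) : ℂ) - c) * u τ = 0 := by rw [sub_mul, h1, sub_self]
  exact (mul_eq_zero.1 this).resolve_left (sub_ne_zero.2 h2)

end Spectrum

section Fourier

open scoped FourierTransform

/-- On `L¹ ∩ L²` the Fourier transform on `L²` is given by the Fourier integral. -/
lemma coeFn_fourier_toLp {f : ℝ → ℂ} (hf : Integrable f) (hf2 : MemLp f 2) :
    ((𝓕 (hf2.toLp) : Lp ℂ 2 (volume : Measure ℝ)) : ℝ → ℂ) =ᵐ[volume] 𝓕 f := by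
  have hcont : Continuous (𝓕 f) :=
    VectorFourier.fourierIntegral_continuous Real.continuous_fourierChar
      (by fun_prop) hf
  refine ae_eq_of_integral_contDiff_smul_eq
    ((Lp.memLp _).locallyIntegrable one_le_two) hcont.locallyIntegrable
    fun g hg hgs => ?_
  have hg' : ContDiff ℝ (⊤ : ℕ∞) fun x => (g x : ℂ) := Complex.ofRealCLM.contDiff.comp hg
  have hgs' : HasCompactSupport fun x => (g x : ℂ) := hgs.comp_left Complex.ofReal_zero
  let φ : SchwartzMap ℝ ℂ := hgs'.toSchwartzMap hg'
  have h1 := DFunLike.congr_fun (Lp.fourier_toTemperedDistribution_eq hf2.toLp) φ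
  rw [TemperedDistribution.fourier_apply, Lp.toTemperedDistribution_apply,
    Lp.toTemperedDistribution_apply] at h1
  have h2 : ∫ x, (𝓕 φ) x • (hf2.toLp : ℝ → ℂ) x = ∫ x, (𝓕 φ) x • f x := by
    refine integral_congr_ae ?_
    filter_upwards [hf2.coeFn_toLp] with x hx
    rw [hx]
  have h3 : ∫ x, (𝓕 (φ : ℝ → ℂ)) x • f x = ∫ x, φ x • (𝓕 f) x := by
    have := VectorFourier.integral_fourierIntegral_smul_eq_flip (μ := volume) (ν := volume)
      (L := innerₗ ℝ) (f := φ) (g := f) Real.continuous_fourierChar continuous_inner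
      φ.integrable hf
    rw [flip_innerₗ] at this
    exact this
  rw [h2, SchwartzMap.fourier_coe, h3] at h1
  exact h1.symm

lemma measurePreserving_neg_real :
    MeasurePreserving (fun x : ℝ => -x) volume volume :=
  Measure.measurePreserving_neg volume

/-- Reflection `u ↦ u(-·)` on `L²(ℝ)`. -/
def reflection : Lp ℂ 2 (volume : Measure ℝ) →ₗᵢ[ℂ] Lp ℂ 2 (volume : Measure ℝ) :=
  Lp.compMeasurePreservingₗᵢ ℂ (fun x : ℝ => -x) measurePreserving_neg_real

lemma coeFn_reflection (u : Lp ℂ 2 (volume : Measure ℝ)) :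
    (reflection u : ℝ → ℂ) =ᵐ[volume] fun x => u (-x) :=
  Lp.coeFn_compMeasurePreserving u measurePreserving_neg_real

lemma fourier_reflection (u : Lp ℂ 2 (volume : Measure ℝ)) :
    𝓕 (reflection u) = reflection (𝓕 u) := by
  refine (SchwartzMap.denseRange_toLpCLM (E := ℝ) (F := ℂ) (p := 2) (μ := volume)
    ENNReal.ofNat_ne_top).induction_on
    (p := fun u => 𝓕 (reflection u) = reflection (𝓕 u)) u
    (isClosed_eq ?_ ?_) fun φ => ?_
  · exact (Lp.fourierTransformₗᵢ ℝ ℂ).continuous.comp reflection.continuous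
  · exact reflection.continuous.comp (Lp.fourierTransformₗᵢ ℝ ℂ).continuous
  · rw [SchwartzMap.toLpCLM_apply]
    have hφ : MemLp φ 2 volume := φ.memLp 2 volume
    have h0 : φ.toLp 2 = hφ.toLp := rfl
    rw [h0]
    have hφ' : MemLp (fun x => φ (-x)) 2 volume :=
      hφ.comp_measurePreserving measurePreserving_neg_real
    have h1 : reflection hφ.toLp = hφ'.toLp := by
      refine Lp.ext ?_
      filter_upwards [coeFn_reflection hφ.toLp, hφ'.coeFn_toLp,
        measurePreserving_neg_real.quasiMeasurePreserving.ae hφ.coeFn_toLp] with x h2 h3 h4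
      rw [h2, h3, h4]
    rw [h1]
    refine Lp.ext ?_
    filter_upwards [coeFn_fourier_toLp φ.integrable.comp_neg hφ',
      coeFn_reflection (𝓕 hφ.toLp), measurePreserving_neg_real.quasiMeasurePreserving.ae
        (coeFn_fourier_toLp φ.integrable hφ)] with x h2 h3 h4
    rw [h2, h3, h4, ← Real.fourierInv_eq_fourier_comp_neg, Real.fourierInv_eq_fourier_neg]

lemma integrable_sech : Integrable fun x : ℝ => (Real.cosh (Real.pi * x))⁻¹ := by
  refine integrable_inv_one_add_sq.mono' continuous_sech.aestronglyMeasurable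
    (Filter.Eventually.of_forall fun x => ?_)
  rw [Real.norm_of_nonneg (sech_mem_Icc x).1]
  refine inv_anti₀ (by positivity) ?_
  have h1 : 1 + (Real.pi * x) ^ 2 / 2 ≤ Real.cosh (Real.pi * x) := by
    have h2 := Real.cosh_sq (Real.pi * x / 2)
    have h3 := Real.cosh_two_mul (Real.pi * x / 2)
    rw [mul_div_cancel₀ _ two_ne_zero] at h3
    have h4 : (Real.pi * x / 2) ^ 2 ≤ Real.sinh (Real.pi * x / 2) ^ 2 := by
      rw [sq_le_sq, Real.abs_sinh]
      exact Real.self_le_sinh_iff.2 (abs_nonneg _)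
    nlinarith
  have h2 : 2 ≤ Real.pi ^ 2 := by nlinarith [Real.pi_gt_three]
  nlinarith [mul_pow Real.pi x 2, mul_le_mul_of_nonneg_right h2 (sq_nonneg x)]

/-- The hyperbolic secant is its own Fourier transform. -/
lemma fourier_sech (ξ : ℝ) :
    𝓕 (fun x : ℝ => (((Real.cosh (Real.pi * x))⁻¹ : ℝ) : ℂ)) ξ =
      (((Real.cosh (Real.pi * ξ))⁻¹ : ℝ) : ℂ) := by
  set φ : ℝ → ℝ := fun x => (1 + Real.exp (-(2 * Real.pi * x)))⁻¹ with hφ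
  have hpos (x : ℝ) : 0 < 1 + Real.exp (-(2 * Real.pi * x)) := by positivity
  have hderiv (x : ℝ) : HasDerivAt φ (2 * Real.pi * Real.exp (-(2 * Real.pi * x)) /
      (1 + Real.exp (-(2 * Real.pi * x))) ^ 2) x := by
    have h1 : HasDerivAt (fun x : ℝ => -(2 * Real.pi * x)) (-(2 * Real.pi)) x := by
      simpa using! ((hasDerivAt_id x).const_mul (2 * Real.pi)).neg
    refine ((h1.exp.const_add 1).inv (hpos x).ne').congr_deriv ?_
    ring
  have himage : φ '' Set.univ = Set.Ioo 0 1 := by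
    ext s
    constructor
    · rintro ⟨x, -, rfl⟩
      exact ⟨inv_pos.2 (hpos x),
        inv_lt_one_of_one_lt₀ (by linarith [Real.exp_pos (-(2 * Real.pi * x))])⟩
    · rintro ⟨h0, h1⟩
      refine ⟨-Real.log (s⁻¹ - 1) / (2 * Real.pi), trivial, ?_⟩
      have h2 : 0 < s⁻¹ - 1 := sub_pos.2 ((one_lt_inv₀ h0).2 h1)
      have h3 : -(2 * Real.pi * (-Real.log (s⁻¹ - 1) / (2 * Real.pi))) = Real.log (s⁻¹ - 1) := by
        field_simp
      simp only [hφ]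
      rw [h3, Real.exp_log h2]
      simp
  have hinj : Set.InjOn φ Set.univ := by
    intro x _ y _ hxy
    have h1 := add_left_cancel (inv_injective hxy)
    have h2 := neg_injective (Real.exp_injective h1)
    exact mul_left_cancel₀ (by positivity) h2
  have hbeta : Complex.betaIntegral (1 / 2 - ξ * Complex.I) (1 / 2 + ξ * Complex.I) =
      Real.pi * (((Real.cosh (Real.pi * ξ))⁻¹ : ℝ) : ℂ) := by
    have h1 := Complex.Gamma_mul_Gamma_eq_betaIntegral (s := 1 / 2 - ξ * Complex.I)
      (t := 1 / 2 + ξ * Complex.I) (by simp) (by simp)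
    have h2 : (1 / 2 - ξ * Complex.I) + (1 / 2 + ξ * Complex.I) = 1 := by ring
    have h3 : (1 / 2 + ξ * Complex.I : ℂ) = 1 - (1 / 2 - ξ * Complex.I) := by ring
    rw [h2, Complex.Gamma_one, one_mul, h3, Complex.Gamma_mul_Gamma_one_sub, ← h3] at h1
    have h4 : Complex.sin (Real.pi * (1 / 2 - ξ * Complex.I)) =
        ((Real.cosh (Real.pi * ξ) : ℝ) : ℂ) := by
      rw [show (Real.pi : ℂ) * (1 / 2 - ξ * Complex.I) =
        Real.pi / 2 - (Real.pi * ξ : ℂ) * Complex.I by ring, Complex.sin_pi_div_two_sub,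
        Complex.cos_mul_I]
      push_cast
      rfl
    rw [← h1, h4, div_eq_mul_inv, Complex.ofReal_inv]
  have hmain : Complex.betaIntegral (1 / 2 - ξ * Complex.I) (1 / 2 + ξ * Complex.I) =
      ∫ x : ℝ, (Real.pi : ℂ) * (Complex.exp (↑(-2 * Real.pi * x * ξ) * Complex.I) •
        (((Real.cosh (Real.pi * x))⁻¹ : ℝ) : ℂ)) := by
    rw [Complex.betaIntegral, intervalIntegral.integral_of_le zero_le_one,
      integral_Ioc_eq_integral_Ioo, ← himage,
      integral_image_eq_integral_abs_deriv_smul MeasurableSet.univ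
        (fun x _ => (hderiv x).hasDerivWithinAt) hinj, Measure.restrict_univ]
    congr 1
    ext x
    set E : ℝ := 1 + Real.exp (-(2 * Real.pi * x)) with hE
    have hEpos : 0 < E := hpos x
    have hφE : φ x = Real.exp (-Real.log E) := by
      rw [Real.exp_neg, Real.exp_log hEpos]
    have h1φ : 1 - φ x = Real.exp (-Real.log E - 2 * Real.pi * x) := by
      rw [sub_eq_add_neg (-Real.log E), Real.exp_add, ← hφE]
      simp only [hφ]
      rw [← hE]
      field_simp
      rw [hE]
      ring
    have hcosh : (Real.cosh (Real.pi * x))⁻¹ = 2 * Real.exp (-Real.log E - Real.pi * x) := by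
      rw [sub_eq_add_neg, Real.exp_add, Real.exp_neg, Real.exp_log hEpos, Real.cosh_eq, hE,
        show -(2 * Real.pi * x) = -(Real.pi * x) + -(Real.pi * x) by ring, Real.exp_add,
        Real.exp_neg]
      have := Real.exp_pos (Real.pi * x)
      field_simp
    have hder : |2 * Real.pi * Real.exp (-(2 * Real.pi * x)) / E ^ 2| =
        2 * Real.pi * Real.exp (-2 * Real.log E - 2 * Real.pi * x) := by
      rw [abs_of_pos (by positivity), show -2 * Real.log E - 2 * Real.pi * x =
        -(2 * Real.pi * x) + (-Real.log E + -Real.log E) by ring, Real.exp_add, Real.exp_add,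
        Real.exp_neg (Real.log E), Real.exp_log hEpos]
      field_simp
    have hcp (a : ℝ) (w : ℂ) : ((Real.exp a : ℝ) : ℂ) ^ w = Complex.exp (a * w) := by
      rw [Complex.ofReal_exp, Complex.cpow_def_of_ne_zero (Complex.exp_ne_zero _),
        ← Complex.ofReal_exp, ← Complex.ofReal_log (Real.exp_pos a).le, Real.log_exp]
    rw [hder, hcosh, show (1 : ℂ) - (φ x : ℂ) = ((1 - φ x : ℝ) : ℂ) by push_cast; rfl,
      h1φ, hφE, hcp, hcp, Complex.real_smul]
    push_cast
    simp only [smul_eq_mul]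
    calc _ = 2 * Real.pi * (Complex.exp (-2 * Real.log E - 2 * Real.pi * x) *
          (Complex.exp (-(Real.log E : ℂ) * (1 / 2 - ξ * Complex.I - 1)) *
          Complex.exp ((-(Real.log E : ℂ) - 2 * Real.pi * x) * (1 / 2 + ξ * Complex.I - 1)))) := by
          ring
      _ = 2 * Real.pi * (Complex.exp (-2 * Real.pi * x * ξ * Complex.I) *
          Complex.exp (-(Real.log E : ℂ) - Real.pi * x)) := by
          rw [← Complex.exp_add, ← Complex.exp_add, ← Complex.exp_add]
          congr 2
          ring
      _ = _ := by ring
  rw [hbeta, integral_const_mul] at hmain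
  rw [Real.fourier_real_eq_integral_exp_smul]
  exact (mul_left_cancel₀ (Complex.ofReal_ne_zero.2 Real.pi_ne_zero) hmain).symm

end Fourier

section Kernels

open Set Filter Topology
open scoped ENNReal

/-- If `F` is increasing on `[a, ∞)` with total increment at most `C`, then `∫ F' ≤ C`. -/
lemma lintegral_Ioi_deriv_le {F F' : ℝ → ℝ} {a C : ℝ} (hderiv : ∀ t ∈ Ici a, HasDerivAt F (F' t) t)
    (hcont : ContinuousOn F' (Ici a)) (hpos : ∀ t ∈ Ici a, 0 ≤ F' t)
    (hC : ∀ t ∈ Ici a, F t - F a ≤ C) :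
    ∫⁻ t in Ioi a, ENNReal.ofReal (F' t) ≤ ENNReal.ofReal C := by
  have hU : ⋃ n : ℕ, Ioc a (a + n) = Ioi a := by
    ext t
    simp only [mem_iUnion, mem_Ioc, mem_Ioi]
    constructor
    · rintro ⟨n, h, -⟩
      exact h
    · intro h
      obtain ⟨n, hn⟩ := exists_nat_ge (t - a)
      exact ⟨n, h, by linarith⟩
  have hdir : Monotone fun n : ℕ => Ioc a (a + n) := fun m n hmn =>
    Ioc_subset_Ioc_right (by gcongr)
  rw [← hU, setLIntegral_iUnion_of_directed _ hdir.directed_le]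
  refine iSup_le fun n => ?_
  have han : a ≤ a + n := by simp
  have hsub : Icc a (a + n) ⊆ Ici a := Icc_subset_Ici_self
  have hkint : IntervalIntegrable F' volume a (a + n) :=
    (hcont.mono (by rw [uIcc_of_le han]; exact hsub)).intervalIntegrable
  have h1 := intervalIntegral.integral_eq_sub_of_hasDerivAt (f := F) (f' := F')
    (fun t ht => hderiv t (by rw [uIcc_of_le han] at ht; exact hsub ht)) hkint
  rw [intervalIntegral.integral_of_le han] at h1
  rw [← ofReal_integral_eq_lintegral_ofReal hkint.1
    ((ae_restrict_iff' measurableSet_Ioc).2 (Eventually.of_forall fun t ht => hpos t ht.1.le)), h1]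
  exact ENNReal.ofReal_le_ofReal (hC _ han)

/-- The kernel of the Mehler operator. -/
def mehlerKernel (t s : ℝ) : ℝ := Real.pi⁻¹ * (2 + t + s)⁻¹

/-- The kernel intertwining the Mehler operator with the convolution by the hyperbolic secant. -/
def sinhKernel (x t : ℝ) : ℝ :=
  Real.sinh (2 * Real.pi * x) * (√(1 + t + Real.cosh (2 * Real.pi * x)))⁻¹ ^ 3

/-- The weight in the Schur tests. -/
def schurWeight (t : ℝ) : ℝ≥0∞ := ENNReal.ofReal (√(1 + |t|))⁻¹

lemma measurable_mehlerKernel : Measurable (Function.uncurry mehlerKernel) := by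
  unfold mehlerKernel Function.uncurry
  fun_prop

lemma measurable_sinhKernel : Measurable (Function.uncurry sinhKernel) := by
  unfold sinhKernel Function.uncurry
  have h1 := Real.measurable_sinh
  have h2 := Real.measurable_cosh
  fun_prop

lemma measurable_schurWeight : Measurable schurWeight := by
  unfold schurWeight
  fun_prop

lemma schurWeight_ne_zero (t : ℝ) : schurWeight t ≠ 0 := by
  have : 0 < 1 + |t| := by positivity
  simp [schurWeight, this]

lemma schurWeight_ne_top (t : ℝ) : schurWeight t ≠ ∞ := ENNReal.ofReal_ne_top

lemma enorm_mul_schurWeight (r : ℝ) {t : ℝ} (ht : 0 < t) :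
    ‖r‖ₑ * schurWeight t = ENNReal.ofReal (|r| * (√(1 + t))⁻¹) := by
  rw [schurWeight, abs_of_pos ht, Real.enorm_eq_ofReal_abs, ENNReal.ofReal_mul (abs_nonneg _)]

lemma hasDerivAt_sqrt_add {a t : ℝ} (h : 0 < a + t) :
    HasDerivAt (fun t => √(a + t)) (1 / (2 * √(a + t))) t :=
  ((hasDerivAt_id t).const_add a).sqrt h.ne'

lemma lintegral_mehlerKernel_le {t : ℝ} (ht : 0 < t) :
    ∫⁻ s in Ioi 0, ‖mehlerKernel t s‖ₑ * schurWeight s ≤ 4 * schurWeight t := by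
  have hA : 0 < √(1 + t) := by positivity
  have h := lintegral_Ioi_deriv_le (a := 0) (F := fun s => -(4 * (√(1 + t) + √(1 + s))⁻¹))
    (F' := fun s => 2 * (√(1 + s))⁻¹ * ((√(1 + t) + √(1 + s)) ^ 2)⁻¹) (C := 4 * (√(1 + t))⁻¹)
    (fun s hs => ?_) ?_ (fun s hs => by positivity) (fun s hs => ?_)
  · have h4 : 4 * schurWeight t = ENNReal.ofReal (4 * (√(1 + t))⁻¹) := by
      rw [schurWeight, abs_of_pos ht, ENNReal.ofReal_mul (by norm_num)]
      norm_num
    rw [h4]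
    refine le_trans (setLIntegral_mono' measurableSet_Ioi fun s (hs : 0 < s) => ?_) h
    rw [enorm_mul_schurWeight _ hs]
    refine ENNReal.ofReal_le_ofReal ?_
    have hB : 0 < √(1 + s) := by positivity
    have hA2 : √(1 + t) ^ 2 = 1 + t := Real.sq_sqrt (by positivity)
    have hB2 : √(1 + s) ^ 2 = 1 + s := Real.sq_sqrt (by positivity)
    have h5 : |mehlerKernel t s| ≤ 2 * ((√(1 + t) + √(1 + s)) ^ 2)⁻¹ := by
      rw [mehlerKernel, abs_of_pos (by positivity)]
      calc Real.pi⁻¹ * (2 + t + s)⁻¹ ≤ 1 * (2 + t + s)⁻¹ := by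
            gcongr
            exact inv_le_one_of_one_le₀ (by linarith [Real.pi_gt_three])
        _ ≤ 2 * ((√(1 + t) + √(1 + s)) ^ 2)⁻¹ := by
            rw [one_mul, ← div_eq_mul_inv, inv_eq_one_div,
              div_le_div_iff₀ (by positivity) (by positivity)]
            nlinarith [sq_nonneg (√(1 + t) - √(1 + s))]
    calc _ ≤ 2 * ((√(1 + t) + √(1 + s)) ^ 2)⁻¹ * (√(1 + s))⁻¹ := by gcongr
      _ = _ := by ring
  · have hs' : (0 : ℝ) ≤ s := hs
    have hB : 0 < √(1 + s) := by positivity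
    refine ((((hasDerivAt_sqrt_add (by positivity : 0 < 1 + s)).const_add (√(1 + t))).inv
      (by positivity)).const_mul 4).neg.congr_deriv ?_
    field_simp
    norm_num
  · refine ContinuousOn.mul (ContinuousOn.mul continuousOn_const (ContinuousOn.inv₀ (by fun_prop)
      fun s (hs : 0 ≤ s) => by positivity)) (ContinuousOn.inv₀ (by fun_prop)
      fun s (hs : 0 ≤ s) => by positivity)
  · have h1 : 0 ≤ 4 * (√(1 + t) + √(1 + s))⁻¹ := by positivity
    have h2 : 4 * (√(1 + t) + √(1 + 0))⁻¹ ≤ 4 * (√(1 + t))⁻¹ := by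
      gcongr
      linarith [Real.sqrt_nonneg (1 + 0)]
    linarith

lemma lintegral_sinhKernel_left_le (x : ℝ) :
    ∫⁻ t in Ioi 0, ‖sinhKernel x t‖ₑ * schurWeight t ≤ 2 := by
  set y := Real.cosh (2 * Real.pi * x) with hy
  have hy1 : 1 ≤ y := Real.one_le_cosh _
  have hy0 : 0 < y := by linarith
  have h := lintegral_Ioi_deriv_le (a := 0)
    (F := fun t => 2 * (√(1 + t) * (√(1 + y + t))⁻¹))
    (F' := fun t => y * (√(1 + y + t))⁻¹ ^ 3 * (√(1 + t))⁻¹) (C := 2)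
    (fun s hs => ?_) ?_ (fun s hs => by positivity) (fun s hs => ?_)
  · rw [show (2 : ℝ≥0∞) = ENNReal.ofReal 2 by norm_num]
    refine le_trans (setLIntegral_mono' measurableSet_Ioi fun s (hs : 0 < s) => ?_) h
    rw [enorm_mul_schurWeight _ hs]
    refine ENNReal.ofReal_le_ofReal ?_
    have h5 : |sinhKernel x s| ≤ y * (√(1 + y + s))⁻¹ ^ 3 := by
      rw [sinhKernel, abs_mul, abs_of_nonneg (by positivity : 0 ≤ (√_)⁻¹ ^ 3), ← hy,
        add_right_comm]
      gcongr
      rw [hy, Real.abs_sinh, ← Real.cosh_abs]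
      exact (Real.sinh_lt_cosh _).le
    gcongr
  · have hs' : (0 : ℝ) ≤ s := hs
    have hB : 0 < √(1 + s) := by positivity
    have hR : 0 < √(1 + y + s) := by positivity
    have hB2 : √(1 + s) ^ 2 = 1 + s := Real.sq_sqrt (by positivity)
    have hR2 : √(1 + y + s) ^ 2 = 1 + y + s := Real.sq_sqrt (by positivity)
    refine (((hasDerivAt_sqrt_add (by positivity : 0 < 1 + s)).mul
      ((hasDerivAt_sqrt_add (by positivity : 0 < 1 + y + s)).inv
      (by positivity))).const_mul 2).congr_deriv ?_
    have hyy : y = √(1 + y + s) ^ 2 - √(1 + s) ^ 2 := by rw [hB2, hR2]; ring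
    simp only [Pi.inv_apply]
    generalize √(1 + y + s) = R at *
    generalize √(1 + s) = B at *
    rw [hyy]
    field_simp
    ring
  · refine ContinuousOn.mul (ContinuousOn.mul continuousOn_const (ContinuousOn.pow
      (ContinuousOn.inv₀ (by fun_prop) fun s (hs : 0 ≤ s) => by positivity) 3))
      (ContinuousOn.inv₀ (by fun_prop) fun s (hs : 0 ≤ s) => by positivity)
  · have hs' : (0 : ℝ) ≤ s := hs
    have h1 : 0 ≤ 2 * (√(1 + 0) * (√(1 + y + 0))⁻¹) := by positivity
    have h2 : √(1 + s) * (√(1 + y + s))⁻¹ ≤ 1 := by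
      rw [← div_eq_mul_inv]
      exact div_le_one_of_le₀ (Real.sqrt_le_sqrt (by linarith)) (by positivity)
    linarith

lemma sinhKernel_neg (x t : ℝ) : sinhKernel (-x) t = -sinhKernel x t := by
  simp [sinhKernel]

lemma lintegral_sinhKernel_right_le {t : ℝ} (ht : 0 < t) :
    ∫⁻ x, ‖sinhKernel x t‖ₑ ≤ 2 * schurWeight t := by
  have hpi := Real.pi_pos
  have h := lintegral_Ioi_deriv_le (a := 0)
    (F := fun x => -(Real.pi⁻¹ * (√(1 + t + Real.cosh (2 * Real.pi * x)))⁻¹))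
    (F' := fun x => sinhKernel x t) (C := (√(1 + t))⁻¹)
    (fun x hx => ?_) ?_ (fun x hx => ?_) (fun x hx => ?_)
  · have h1 : ∫⁻ x in Ioi 0, ‖sinhKernel x t‖ₑ ≤ schurWeight t := by
      rw [schurWeight, abs_of_pos ht]
      refine le_trans (setLIntegral_mono' measurableSet_Ioi fun x (hx : 0 < x) => ?_) h
      rw [Real.enorm_eq_ofReal_abs, abs_of_nonneg]
      exact mul_nonneg (Real.sinh_nonneg_iff.2 (by positivity)) (by positivity)
    have h2 : ∫⁻ x in Iic 0, ‖sinhKernel x t‖ₑ ≤ schurWeight t := by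
      refine le_trans (le_of_eq ?_) h1
      rw [setLIntegral_congr Iio_ae_eq_Iic.symm,
        ← (Measure.measurePreserving_neg (volume : Measure ℝ)).setLIntegral_comp_preimage
        measurableSet_Ioi
        (by exact (measurable_sinhKernel.comp (measurable_id.prodMk measurable_const)).enorm)]
      simp [sinhKernel_neg]
    rw [← lintegral_add_compl _ measurableSet_Ioi, compl_Ioi, two_mul]
    exact add_le_add h1 h2
  · have hR : 0 < √(1 + t + Real.cosh (2 * Real.pi * x)) := by positivity
    have h1 : HasDerivAt (fun x => 2 * Real.pi * x) (2 * Real.pi) x := by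
      simpa using (hasDerivAt_id x).const_mul (2 * Real.pi)
    have h2 := (((h1.cosh.const_add (1 + t)).sqrt (by positivity)).inv
      (by positivity)).const_mul Real.pi⁻¹
    refine h2.neg.congr_deriv ?_
    rw [sinhKernel]
    field_simp
  · refine Continuous.continuousOn ?_
    unfold sinhKernel
    exact (Real.continuous_sinh.comp (by fun_prop)).mul ((Continuous.inv₀
      (by have := Real.continuous_cosh; fun_prop) fun x => by positivity).pow 3)
  · have hx' : (0 : ℝ) ≤ x := hx
    exact mul_nonneg (Real.sinh_nonneg_iff.2 (by positivity)) (by positivity)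
  · have h1 : 0 ≤ Real.pi⁻¹ * (√(1 + t + Real.cosh (2 * Real.pi * x)))⁻¹ := by positivity
    have h2 : Real.pi⁻¹ * (√(1 + t + Real.cosh (2 * Real.pi * 0)))⁻¹ ≤ 1 * (√(1 + t))⁻¹ := by
      refine mul_le_mul (inv_le_one_of_one_le₀ (by linarith [Real.pi_gt_three]))
        (inv_anti₀ (by positivity) (Real.sqrt_le_sqrt (by simp))) (by positivity) zero_le_one
    linarith

end Kernels

section KernelIdentity

open Set Filter Topology

lemma integrable_sinhKernel {s : ℝ} (hs : 0 < s) : Integrable fun x => sinhKernel x s := by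
  refine ⟨(measurable_sinhKernel.comp
    (measurable_id.prodMk measurable_const)).aestronglyMeasurable, ?_⟩
  exact (lintegral_sinhKernel_right_le hs).trans_lt
    (ENNReal.mul_lt_top ENNReal.ofNat_lt_top (schurWeight_ne_top s).lt_top)

lemma integrable_sech_mul {f : ℝ → ℝ} (hf : Integrable f) (x : ℝ) :
    Integrable fun x' => (Real.cosh (Real.pi * (x - x')))⁻¹ * f x' := by
  refine hf.bdd_mul (c := 1)
    (continuous_sech.comp (continuous_const.sub continuous_id)).aestronglyMeasurable
    (Eventually.of_forall fun x' => ?_)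
  rw [Real.norm_of_nonneg (sech_mem_Icc _).1]
  exact (sech_mem_Icc _).2

lemma integral_eq_integral_Ioi_add_neg {E : Type*} [NormedAddCommGroup E] [NormedSpace ℝ E]
    {f : ℝ → E} (hf : Integrable f) :
    ∫ x, f x = ∫ x in Ioi 0, (f x + f (-x)) := by
  rw [integral_add hf.integrableOn hf.comp_neg.integrableOn, integral_comp_neg_Ioi, neg_zero,
    add_comm, ← compl_Ioi, add_comm, integral_add_compl measurableSet_Ioi hf]

/-- The kernel `sinhKernel` intertwines the Mehler kernel with the convolution kernel given
by the hyperbolic secant of `π (x - y)`. -/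
lemma integral_sinhKernel_mul_mehlerKernel (x : ℝ) {s : ℝ} (hs : 0 < s) :
    ∫ t in Ioi 0, sinhKernel x t * mehlerKernel t s =
      ∫ x', (Real.cosh (Real.pi * (x - x')))⁻¹ * sinhKernel x' s := by
  have hpi := Real.pi_pos
  rw [integral_eq_integral_Ioi_add_neg (integrable_sech_mul (integrable_sinhKernel hs) x)]
  set a := Real.cosh (Real.pi * x) with ha
  have ha0 : 0 < a := Real.cosh_pos _
  have hsinh {r : ℝ} (hr : 0 < r) : 0 < Real.sinh (Real.pi * r) :=
    Real.sinh_pos_iff.2 (by positivity)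
  set φ : ℝ → ℝ := fun r => a ^ 2 * (2 + s) * (Real.sinh (Real.pi * r) ^ 2)⁻¹ with hφ
  have hderiv : ∀ r ∈ Ioi (0 : ℝ), HasDerivWithinAt φ
      (-(2 * Real.pi * a ^ 2 * (2 + s) * Real.cosh (Real.pi * r) / Real.sinh (Real.pi * r) ^ 3))
      (Ioi 0) r := by
    intro r hr
    have hp := hsinh hr
    have h1 : HasDerivAt (fun r => Real.pi * r) Real.pi r := by
      simpa using (hasDerivAt_id r).const_mul Real.pi
    refine (((h1.sinh.pow 2).inv (pow_pos hp 2).ne').const_mul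
      (a ^ 2 * (2 + s))).hasDerivWithinAt.congr_deriv ?_
    field_simp
    norm_num
    ring
  have hinj : InjOn φ (Ioi 0) := by
    intro r hr r' hr' h
    have h1 := inv_injective (mul_left_cancel₀ (by positivity : a ^ 2 * (2 + s) ≠ 0) h)
    have h2 := (pow_left_inj₀ (hsinh hr).le (hsinh hr').le two_ne_zero).1 h1
    exact mul_left_cancel₀ hpi.ne' (Real.sinh_injective h2)
  have himage : φ '' Ioi 0 = Ioi 0 := by
    ext t
    constructor
    · rintro ⟨r, hr, rfl⟩
      have hp := hsinh hr
      exact mul_pos (by positivity : 0 < a ^ 2 * (2 + s)) (inv_pos.2 (pow_pos hp 2))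
    · intro ht
      have ht : 0 < t := ht
      refine ⟨Real.arsinh (a * √((2 + s) / t)) / Real.pi,
        div_pos (Real.arsinh_pos_iff.2 (by positivity)) hpi, ?_⟩
      simp only [hφ]
      rw [mul_div_cancel₀ _ hpi.ne', Real.sinh_arsinh, mul_pow, Real.sq_sqrt (by positivity)]
      field_simp
  rw [← himage, integral_image_eq_integral_abs_deriv_smul measurableSet_Ioi hderiv hinj]
  rw [himage]
  refine setIntegral_congr_fun measurableSet_Ioi fun r hr => ?_
  have hp := hsinh hr
  have hq := Real.cosh_pos (Real.pi * r)
  have hq2 := Real.cosh_sq (Real.pi * r)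
  have ha2 := Real.cosh_sq (Real.pi * x)
  simp only [smul_eq_mul, sinhKernel_neg]
  have hS : Real.sinh (2 * Real.pi * x) = 2 * Real.sinh (Real.pi * x) * a := by
    rw [mul_assoc, Real.sinh_two_mul]
  have hS' : Real.sinh (2 * Real.pi * r) =
      2 * Real.sinh (Real.pi * r) * Real.cosh (Real.pi * r) := by
    rw [mul_assoc, Real.sinh_two_mul]
  have hC : Real.cosh (2 * Real.pi * x) = 2 * a ^ 2 - 1 := by
    rw [mul_assoc, Real.cosh_two_mul]; linarith
  have hC' : Real.cosh (2 * Real.pi * r) = 2 * Real.sinh (Real.pi * r) ^ 2 + 1 := by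
    rw [mul_assoc, Real.cosh_two_mul]; linarith
  have h1 : Real.cosh (Real.pi * (x - r)) = a * Real.cosh (Real.pi * r) -
      Real.sinh (Real.pi * x) * Real.sinh (Real.pi * r) := by
    rw [mul_sub, Real.cosh_sub]
  have h2 : Real.cosh (Real.pi * (x - -r)) = a * Real.cosh (Real.pi * r) +
      Real.sinh (Real.pi * x) * Real.sinh (Real.pi * r) := by
    rw [sub_neg_eq_add, mul_add, Real.cosh_add]
  have h1p := Real.cosh_pos (Real.pi * (x - r))
  have h2p := Real.cosh_pos (Real.pi * (x - -r))
  rw [h1] at h1p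
  rw [h2] at h2p
  have h3 : √(1 + φ r + Real.cosh (2 * Real.pi * x)) =
      a / Real.sinh (Real.pi * r) * √(1 + s + Real.cosh (2 * Real.pi * r)) := by
    rw [← Real.sqrt_sq (div_pos ha0 hp).le, ← Real.sqrt_mul (by positivity), hC, hC']
    congr 1
    simp only [hφ]
    field_simp
    ring
  rw [sinhKernel, sinhKernel, mehlerKernel, h1, h2, h3, hS, hS', abs_neg,
    abs_of_pos (by positivity)]
  have hR : 0 < √(1 + s + Real.cosh (2 * Real.pi * r)) := by positivity
  simp only [hφ]
  generalize √(1 + s + Real.cosh (2 * Real.pi * r)) = R at *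
  generalize Real.sinh (Real.pi * r) = p at *
  generalize Real.cosh (Real.pi * r) = q at *
  rw [← ha] at ha2
  generalize Real.sinh (Real.pi * x) = b at *
  have h4 : (a * q - b * p)⁻¹ - (a * q + b * p)⁻¹ = 2 * b * p / (a ^ 2 + p ^ 2) := by
    have h5 : a ^ 2 + p ^ 2 = (a * q - b * p) * (a * q + b * p) := by
      linear_combination -a ^ 2 * hq2 - p ^ 2 * ha2
    rw [h5, inv_sub_inv h1p.ne' h2p.ne']
    ring
  have h6 : 2 + a ^ 2 * (2 + s) * (p ^ 2)⁻¹ + s = (2 + s) * (a ^ 2 + p ^ 2) / p ^ 2 := by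
    field_simp
    ring
  rw [h6]
  calc _ = 2 * b * p / (a ^ 2 + p ^ 2) * (2 * p * q * R⁻¹ ^ 3) := by
        field_simp
    _ = _ := by
        rw [← h4]
        ring

end KernelIdentity

section Intertwining

open Set Filter Topology
open scoped FourierTransform ENNReal Convolution

variable {u : ℝ → ℂ}

lemma integrable_sinhKernel_mul_inv_sqrt (x : ℝ) :
    Integrable (fun t => sinhKernel x t * (√(1 + t))⁻¹) muPlus := by
  refine ⟨?_, ?_⟩
  · refine Measurable.aestronglyMeasurable ?_
    have : Measurable fun t => sinhKernel x t :=
      measurable_sinhKernel.comp (measurable_const.prodMk measurable_id)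
    fun_prop
  · refine lt_of_eq_of_lt (setLIntegral_congr_fun measurableSet_Ioi fun t (ht : 0 < t) => ?_)
      ((lintegral_sinhKernel_left_le x).trans_lt ENNReal.ofNat_lt_top)
    simp only
    rw [enorm_mul_schurWeight _ ht, Real.enorm_eq_ofReal_abs, abs_mul,
      abs_of_nonneg (by positivity : 0 ≤ (√(1 + t))⁻¹)]

lemma mehlerKernel_mul_sqrt_le {t s : ℝ} (ht : 0 < t) (hs : 0 < s) :
    ‖mehlerKernel t s * √(1 + t)‖ ≤ 1 := by
  have hpi := Real.pi_pos
  rw [mehlerKernel, Real.norm_of_nonneg (by positivity)]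
  have h1 : √(1 + t) ≤ 2 + t + s := (Real.sqrt_le_sqrt_iff (by positivity)).2
    (by nlinarith : 1 + t ≤ (2 + t + s) ^ 2) |>.trans_eq (Real.sqrt_sq (by positivity))
  calc Real.pi⁻¹ * (2 + t + s)⁻¹ * √(1 + t) ≤ 1 * (2 + t + s)⁻¹ * (2 + t + s) := by
        gcongr
        exact inv_le_one_of_one_le₀ (by linarith [Real.pi_gt_three])
    _ = 1 := by field_simp

lemma ae_pos_prod_muPlus : ∀ᵐ z ∂(muPlus.prod muPlus), 0 < z.1 ∧ 0 < z.2 := by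
  rw [Measure.prod_restrict]
  filter_upwards [ae_restrict_mem (measurableSet_Ioi.prod measurableSet_Ioi)] with z hz
  exact hz

lemma integrable_sinhKernel_mul_mehlerKernel_mul (hu : Integrable u muPlus) (x : ℝ) :
    Integrable (fun z : ℝ × ℝ => (sinhKernel x z.1 : ℂ) * ((mehlerKernel z.1 z.2 : ℂ) * u z.2))
      (muPlus.prod muPlus) := by
  have h1 := ((integrable_sinhKernel_mul_inv_sqrt x).ofReal (𝕜 := ℂ)).mul_prod hu
  have h2 := h1.bdd_mul (f := fun z => ((mehlerKernel z.1 z.2 * √(1 + z.1) : ℝ) : ℂ)) (c := 1)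
    ?_ ?_
  · refine h2.congr ?_
    filter_upwards [ae_pos_prod_muPlus] with z hz
    have h3 : √(1 + z.1) * (√(1 + z.1))⁻¹ = 1 := by
      have := hz.1
      exact mul_inv_cancel₀ (by positivity)
    have h4 : ((√(1 + z.1) : ℝ) : ℂ) * (((√(1 + z.1))⁻¹ : ℝ) : ℂ) = 1 := by
      rw [← Complex.ofReal_mul, h3, Complex.ofReal_one]
    simp only [Complex.coe_algebraMap]
    push_cast at h4 ⊢
    linear_combination (mehlerKernel z.1 z.2 : ℂ) * sinhKernel x z.1 * u z.2 * h4
  · have := measurable_mehlerKernel.comp (measurable_fst.prodMk (measurable_snd (α := ℝ) (β := ℝ)))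
    refine Measurable.aestronglyMeasurable (Complex.measurable_ofReal.comp (Measurable.mul this ?_))
    fun_prop
  · filter_upwards [ae_pos_prod_muPlus] with z hz
    rw [Complex.norm_real]
    exact mehlerKernel_mul_sqrt_le hz.1 hz.2

lemma integrable_sinhKernel_mul (hu : Integrable u muPlus) :
    Integrable (fun z : ℝ × ℝ => (sinhKernel z.1 z.2 : ℂ) * u z.2)
      ((volume : Measure ℝ).prod muPlus) := by
  have hm : AEStronglyMeasurable (fun z : ℝ × ℝ => (sinhKernel z.1 z.2 : ℂ) * u z.2)
      ((volume : Measure ℝ).prod muPlus) :=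
    (Complex.measurable_ofReal.comp measurable_sinhKernel).aestronglyMeasurable.mul
      hu.aestronglyMeasurable.comp_snd
  refine ⟨hm, ?_⟩
  rw [HasFiniteIntegral, lintegral_prod_symm _ hm.enorm]
  have h2 : ∫⁻ y, 2 * ‖u y‖ₑ ∂muPlus < ∞ := by
    rw [lintegral_const_mul' _ _ ENNReal.ofNat_ne_top]
    exact ENNReal.mul_lt_top ENNReal.ofNat_lt_top hu.2
  refine (setLIntegral_mono_ae' measurableSet_Ioi (Eventually.of_forall
    fun s (hs : 0 < s) => ?_)).trans_lt h2
  simp only [enorm_mul]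
  rw [lintegral_mul_const' _ _ enorm_ne_top]
  gcongr
  have h3 : schurWeight s ≤ 1 := by
    rw [schurWeight, ← ENNReal.ofReal_one]
    refine ENNReal.ofReal_le_ofReal (inv_le_one_of_one_le₀ (Real.one_le_sqrt.2 ?_))
    linarith [abs_nonneg s]
  have h4 (x : ℝ) : ‖(sinhKernel x s : ℂ)‖ₑ = ‖sinhKernel x s‖ₑ := by
    rw [← ofReal_norm, ← ofReal_norm, Complex.norm_real]
  simp only [h4]
  calc _ ≤ 2 * schurWeight s := lintegral_sinhKernel_right_le hs
    _ ≤ 2 * 1 := by gcongr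
    _ = 2 := mul_one 2

lemma integral_sinhKernel_integral_mehlerKernel (hu : Integrable u muPlus) (x : ℝ) :
    ∫ t, (sinhKernel x t : ℂ) * (∫ s, (mehlerKernel t s : ℂ) * u s ∂muPlus) ∂muPlus =
      ∫ x', (∫ s, (sinhKernel x' s : ℂ) * u s ∂muPlus) *
        (((Real.cosh (Real.pi * (x - x')))⁻¹ : ℝ) : ℂ) := by
  have hsech : Continuous fun x' : ℝ => (((Real.cosh (Real.pi * (x - x')))⁻¹ : ℝ) : ℂ) :=
    Complex.continuous_ofReal.comp (continuous_sech.comp (continuous_const.sub continuous_id))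
  have hsech' : Continuous fun z : ℝ × ℝ => (((Real.cosh (Real.pi * (x - z.1)))⁻¹ : ℝ) : ℂ) :=
    hsech.comp continuous_fst
  have hI := (integrable_sinhKernel_mul hu).mul_bdd (c := 1)
    hsech'.aestronglyMeasurable (Eventually.of_forall fun z => by
      rw [Complex.norm_real, Real.norm_of_nonneg (sech_mem_Icc _).1]
      exact (sech_mem_Icc _).2)
  have h1 := integral_integral_swap
    (f := fun t s => (sinhKernel x t : ℂ) * ((mehlerKernel t s : ℂ) * u s))
    (integrable_sinhKernel_mul_mehlerKernel_mul hu x)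
  have h2 := integral_integral_swap
    (f := fun x' s => (sinhKernel x' s : ℂ) * u s *
      (((Real.cosh (Real.pi * (x - x')))⁻¹ : ℝ) : ℂ)) hI
  simp only [← integral_const_mul, ← integral_mul_const]
  refine h1.trans (Eq.trans ?_ h2.symm)
  refine setIntegral_congr_fun measurableSet_Ioi fun s hs => ?_
  have h := congrArg (fun r : ℝ => (r : ℂ) * u s) (integral_sinhKernel_mul_mehlerKernel x hs)
  simp only [← integral_complex_ofReal, ← integral_mul_const] at h
  calc _ = ∫ t in Ioi 0, ((sinhKernel x t * mehlerKernel t s : ℝ) : ℂ) * u s := by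
        congr 1
        ext t
        push_cast
        ring
    _ = _ := h
    _ = _ := by
        congr 1
        ext t
        push_cast
        ring

/-- For integrable `u` the transform `𝓕 W` diagonalises the Mehler operator. -/
lemma fourier_sinhOperator_mehler {M : L2plus →L[ℂ] L2plus}
    {W : L2plus →L[ℂ] Lp ℂ 2 (volume : Measure ℝ)}
    (hM : ∀ u, ∀ᵐ t ∂muPlus, M u t = ∫ s, (mehlerKernel t s : ℂ) * u s ∂muPlus)
    (hW : ∀ u, ∀ᵐ x, W u x = ∫ t, (sinhKernel x t : ℂ) * u t ∂muPlus) {u : L2plus}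
    (hu : Integrable u muPlus) :
    ∀ᵐ ξ, 𝓕 (W (M u)) ξ = (((Real.cosh (Real.pi * ξ))⁻¹ : ℝ) : ℂ) * 𝓕 (W u) ξ := by
  set f : ℝ → ℂ := fun x => ∫ t, (sinhKernel x t : ℂ) * u t ∂muPlus with hf
  set σ : ℝ → ℂ := fun x => (((Real.cosh (Real.pi * x))⁻¹ : ℝ) : ℂ) with hσ
  have hfi : Integrable f := (integrable_sinhKernel_mul hu).integral_prod_left
  have hσi : Integrable σ := integrable_sech.ofReal
  have hf2 : MemLp f 2 := (memLp_congr_ae (hW u)).1 (Lp.memLp _)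
  have hfW : W u = hf2.toLp := Lp.ext (EventuallyEq.trans (hW u) hf2.coeFn_toLp.symm)
  have hconv : ∀ᵐ x, W (M u) x = (f ⋆[ContinuousLinearMap.mul ℂ ℂ] σ) x := by
    filter_upwards [hW (M u)] with x hx
    rw [hx, convolution_def]
    simp only [ContinuousLinearMap.mul_apply']
    rw [← integral_sinhKernel_integral_mehlerKernel hu x]
    refine integral_congr_ae ?_
    filter_upwards [hM u] with t ht
    rw [ht]
  have hg2 : MemLp (f ⋆[ContinuousLinearMap.mul ℂ ℂ] σ) 2 :=
    (memLp_congr_ae hconv).1 (Lp.memLp _)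
  have hgW : W (M u) = hg2.toLp := 
    Lp.ext (EventuallyEq.trans hconv hg2.coeFn_toLp.symm)
  have hgi : Integrable (f ⋆[ContinuousLinearMap.mul ℂ ℂ] σ) :=
    hfi.integrable_convolution _ hσi
  rw [hfW, hgW]
  filter_upwards [coeFn_fourier_toLp hfi hf2, coeFn_fourier_toLp hgi hg2] with ξ h1 h2
  rw [h1, h2, Real.fourier_mul_convolution_eq hfi hσi, hσ, fourier_sech, mul_comm]

lemma dense_integrable : Dense {u : L2plus | Integrable u muPlus} := by
  refine (Lp.simpleFunc.denseRange (E := ℂ) (p := 2) (μ := muPlus) ENNReal.ofNat_ne_top).mono ?_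
  rintro _ ⟨f, rfl⟩
  exact ((SimpleFunc.memLp_iff_integrable two_ne_zero ENNReal.ofNat_ne_top).1
    (Lp.simpleFunc.memLp f)).congr (Lp.simpleFunc.toSimpleFunc_eq_toFun f)

end Intertwining

section Moments

open Set Filter Topology

variable {c d : ℝ → ℝ} {g : ℝ → ℂ}

lemma hasDerivAt_inv_sqrt_pow (n : ℕ) {r : ℝ} (hr : 0 < r) :
    HasDerivAt (fun r => (√r)⁻¹ ^ (2 * n + 3))
      (-((2 * n + 3) / 2) * (√r)⁻¹ ^ (2 * (n + 1) + 3)) r := by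
  have h : 0 < √r := Real.sqrt_pos.2 hr
  refine ((((hasDerivAt_id r).sqrt hr.ne').inv h.ne').pow (2 * n + 3)).congr_deriv ?_
  rw [show 2 * (n + 1) + 3 = (2 * n + 2) + 3 by ring, show 2 * n + 3 - 1 = 2 * n + 2 by omega,
    pow_add _ _ 3]
  simp only [Pi.inv_apply, id]
  push_cast
  field_simp

lemma inv_sqrt_pow_le (n : ℕ) {r r' : ℝ} (hr : 1 ≤ r) (hr' : r ≤ r') :
    (√r')⁻¹ ^ (2 * n + 3) ≤ (√r)⁻¹ ^ 3 := by
  have h1 : 1 ≤ √r := Real.one_le_sqrt.2 hr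
  calc (√r')⁻¹ ^ (2 * n + 3) ≤ (√r)⁻¹ ^ (2 * n + 3) := by gcongr
    _ ≤ (√r)⁻¹ ^ 3 := pow_le_pow_of_le_one (by positivity) (inv_le_one_of_one_le₀ h1) (by omega)

lemma integrableOn_inv_sqrt_pow (hc : Continuous c) (hc0 : ∀ x ∈ Ioi (0 : ℝ), 0 ≤ c x)
    (hgm : AEStronglyMeasurable g muPlus)
    (hg : Integrable (fun x => (((√(1 + c x))⁻¹ ^ 3 : ℝ) : ℂ) * g x) muPlus) (n : ℕ) {t : ℝ}
    (ht : 0 < t) :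
    Integrable (fun x => (((√(2 + t + c x))⁻¹ ^ (2 * n + 3) : ℝ) : ℂ) * g x) muPlus := by
  refine hg.mono ?_ ?_
  · refine AEStronglyMeasurable.mul (Measurable.aestronglyMeasurable ?_) hgm
    have := hc.measurable
    fun_prop
  · filter_upwards [ae_restrict_mem measurableSet_Ioi] with x hx
    have := hc0 x hx
    rw [norm_mul, norm_mul, Complex.norm_real, Complex.norm_real,
      Real.norm_of_nonneg (by positivity), Real.norm_of_nonneg (by positivity)]
    exact mul_le_mul_of_nonneg_right (inv_sqrt_pow_le n (by linarith) (by linarith))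
      (norm_nonneg _)

lemma hasDerivAt_integral_inv_sqrt_pow (hc : Continuous c) (hc0 : ∀ x ∈ Ioi (0 : ℝ), 0 ≤ c x)
    (hgm : AEStronglyMeasurable g muPlus)
    (hg : Integrable (fun x => (((√(1 + c x))⁻¹ ^ 3 : ℝ) : ℂ) * g x) muPlus) (n : ℕ) {t : ℝ}
    (ht : 0 < t) :
    HasDerivAt (fun t => ∫ x, (((√(2 + t + c x))⁻¹ ^ (2 * n + 3) : ℝ) : ℂ) * g x ∂muPlus)
      (-((2 * n + 3) / 2) *
        ∫ x, (((√(2 + t + c x))⁻¹ ^ (2 * (n + 1) + 3) : ℝ) : ℂ) * g x ∂muPlus) t := by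
  have h := hasDerivAt_integral_of_dominated_loc_of_deriv_le (μ := muPlus) (x₀ := t)
    (s := Ioi (0 : ℝ))
    (F := fun t x => (((√(2 + t + c x))⁻¹ ^ (2 * n + 3) : ℝ) : ℂ) * g x)
    (F' := fun t x =>
      ((-((2 * n + 3) / 2) * (√(2 + t + c x))⁻¹ ^ (2 * (n + 1) + 3) : ℝ) : ℂ) * g x)
    (bound := fun x => (2 * n + 3) / 2 * ‖(((√(1 + c x))⁻¹ ^ 3 : ℝ) : ℂ) * g x‖)
    (Ioi_mem_nhds ht) ?_ (integrableOn_inv_sqrt_pow hc hc0 hgm hg n ht) ?_ ?_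
    (hg.norm.const_mul _) ?_
  · refine h.2.congr_deriv ?_
    rw [← integral_const_mul]
    congr 1
    ext x
    push_cast
    ring
  · filter_upwards [Ioi_mem_nhds ht] with t ht
    exact (integrableOn_inv_sqrt_pow hc hc0 hgm hg n ht).aestronglyMeasurable
  · refine AEStronglyMeasurable.mul (Measurable.aestronglyMeasurable ?_) hgm
    have := hc.measurable
    fun_prop
  · filter_upwards [ae_restrict_mem measurableSet_Ioi] with x hx t (ht : 0 < t)
    have := hc0 x hx
    rw [norm_mul, norm_mul, Complex.norm_real, Complex.norm_real, norm_mul, norm_neg,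
      Real.norm_of_nonneg (by positivity), Real.norm_of_nonneg (by positivity),
      Real.norm_of_nonneg (by positivity), mul_assoc]
    gcongr
    exact inv_sqrt_pow_le (n + 1) (by linarith) (by linarith)
  · filter_upwards [ae_restrict_mem measurableSet_Ioi] with x hx t (ht : 0 < t)
    have := hc0 x hx
    have h1 : HasDerivAt (fun t => 2 + t + c x) 1 t :=
      ((hasDerivAt_id t).const_add 2).add_const (c x)
    have h2 := (hasDerivAt_inv_sqrt_pow n (by positivity : 0 < 2 + t + c x)).comp t h1
    rw [mul_one] at h2
    exact h2.ofReal_comp.mul_const (g x)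

lemma integral_inv_sqrt_pow_eq_zero (hc : Continuous c) (hc0 : ∀ x ∈ Ioi (0 : ℝ), 0 ≤ c x)
    (hgm : AEStronglyMeasurable g muPlus)
    (hg : Integrable (fun x => (((√(1 + c x))⁻¹ ^ 3 : ℝ) : ℂ) * g x) muPlus)
    (h0 : ∀ t > 0, ∫ x, (((√(2 + t + c x))⁻¹ ^ 3 : ℝ) : ℂ) * g x ∂muPlus = 0) (n : ℕ) :
    ∀ t > 0, ∫ x, (((√(2 + t + c x))⁻¹ ^ (2 * n + 3) : ℝ) : ℂ) * g x ∂muPlus = 0 := by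
  induction n with
  | zero => simpa using h0
  | succ n ih =>
    intro t ht
    have h1 := hasDerivAt_integral_inv_sqrt_pow hc hc0 hgm hg n ht
    have h2 : HasDerivAt
        (fun t => ∫ x, (((√(2 + t + c x))⁻¹ ^ (2 * n + 3) : ℝ) : ℂ) * g x ∂muPlus) 0 t :=
      (hasDerivAt_const t 0).congr_of_eventuallyEq (by
        filter_upwards [Ioi_mem_nhds ht] with t ht using ih t ht)
    refine (mul_eq_zero.1 (h1.unique h2)).resolve_left ?_
    refine neg_ne_zero.2 (div_ne_zero ?_ two_ne_zero)
    exact_mod_cast (by positivity : 2 * n + 3 ≠ 0)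

lemma integral_comp_inv_mul_eq_zero (hc : Continuous c) (hc0 : ∀ x ∈ Ioi (0 : ℝ), 0 ≤ c x)
    (hgm : AEStronglyMeasurable g muPlus)
    (hg : Integrable (fun x => (((√(1 + c x))⁻¹ ^ 3 : ℝ) : ℂ) * g x) muPlus)
    (h0 : ∀ t > 0, ∫ x, (((√(2 + t + c x))⁻¹ ^ 3 : ℝ) : ℂ) * g x ∂muPlus = 0)
    {φ : ℝ → ℝ} (hφ : Continuous φ) :
    ∫ x, (φ (3 + c x)⁻¹ : ℂ) * ((((√(3 + c x))⁻¹ ^ 3 : ℝ) : ℂ) * g x) ∂muPlus = 0 := by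
  have h3 (n : ℕ) := integral_inv_sqrt_pow_eq_zero hc hc0 hgm hg h0 n 1 one_pos
  have hI (n : ℕ) := integrableOn_inv_sqrt_pow hc hc0 hgm hg n one_pos
  have h21 : (2 : ℝ) + 1 = 3 := by norm_num
  simp only [h21] at h3 hI
  have hI0 := hI 0
  norm_num only at hI0
  have hmem : ∀ x ∈ Ioi (0 : ℝ), (3 + c x)⁻¹ ∈ Icc (0 : ℝ) 1 := fun x hx => by
    have := hc0 x hx
    exact ⟨by positivity, inv_le_one_of_one_le₀ (by linarith)⟩
  have hpow (n : ℕ) : ∀ x ∈ Ioi (0 : ℝ), (((√(3 + c x))⁻¹ ^ (2 * n + 3) : ℝ) : ℂ) * g x =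
      (((3 + c x)⁻¹ ^ n : ℝ) : ℂ) * ((((√(3 + c x))⁻¹ ^ 3 : ℝ) : ℂ) * g x) := fun x hx => by
    have := hc0 x hx
    rw [pow_add, pow_mul, inv_pow (√_) 2, Real.sq_sqrt (by positivity), Complex.ofReal_mul,
      mul_assoc]
  have hbdd {ψ : ℝ → ℝ} (hψ : Continuous ψ) {C : ℝ} (hC : ∀ y ∈ Icc (0 : ℝ) 1, ‖ψ y‖ ≤ C) :
      Integrable (fun x => (ψ (3 + c x)⁻¹ : ℂ) * ((((√(3 + c x))⁻¹ ^ 3 : ℝ) : ℂ) * g x))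
        muPlus := by
    refine hI0.bdd_mul (c := C) (Measurable.aestronglyMeasurable ?_) ?_
    · have := hc.measurable
      have := hψ.measurable
      fun_prop
    · filter_upwards [ae_restrict_mem measurableSet_Ioi] with x hx
      rw [Complex.norm_real]
      exact hC _ (hmem x hx)
  have hbd {ψ : ℝ → ℝ} (hψ : Continuous ψ) :
      Integrable (fun x => (ψ (3 + c x)⁻¹ : ℂ) * ((((√(3 + c x))⁻¹ ^ 3 : ℝ) : ℂ) * g x))
        muPlus := by
    obtain ⟨C, hC⟩ := isCompact_Icc.exists_bound_of_continuousOn hψ.continuousOn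
    exact hbdd hψ hC
  have hpoly (P : Polynomial ℝ) :
      ∫ x, ((P.eval (3 + c x)⁻¹ : ℝ) : ℂ) * ((((√(3 + c x))⁻¹ ^ 3 : ℝ) : ℂ) * g x) ∂muPlus = 0 := by
    induction P using Polynomial.induction_on' with
    | add P Q hP hQ =>
      simp only [Polynomial.eval_add, Complex.ofReal_add, add_mul]
      rw [integral_add (hbd P.continuous) (hbd Q.continuous), hP, hQ, add_zero]
    | monomial n a =>
      simp only [Polynomial.eval_monomial, Complex.ofReal_mul, mul_assoc]
      rw [integral_const_mul]
      have h4 := h3 n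
      rw [setIntegral_congr_fun measurableSet_Ioi (hpow n)] at h4
      rw [h4, mul_zero]
  refine norm_le_zero_iff.1 (le_of_forall_pos_le_add fun ε hε => ?_)
  set A := ∫ x, ‖(((√(3 + c x))⁻¹ ^ 3 : ℝ) : ℂ) * g x‖ ∂muPlus with hA
  have hA0 : 0 ≤ A := integral_nonneg fun x => norm_nonneg _
  obtain ⟨P, hP⟩ := exists_polynomial_near_of_continuousOn 0 1 φ hφ.continuousOn (ε / (A + 1))
    (by positivity)
  rw [← sub_zero (∫ x, _ ∂muPlus), ← hpoly P, ← integral_sub (hbd hφ) (hbd P.continuous), zero_add]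
  calc _ ≤ ∫ x, ε / (A + 1) * ‖(((√(3 + c x))⁻¹ ^ 3 : ℝ) : ℂ) * g x‖ ∂muPlus := by
        refine norm_integral_le_of_norm_le (hI0.norm.const_mul _) ?_
        filter_upwards [ae_restrict_mem measurableSet_Ioi] with x hx
        rw [← sub_mul, norm_mul, ← Complex.ofReal_sub, Complex.norm_real, norm_sub_rev]
        gcongr
        exact (hP _ (hmem x hx)).le
    _ = ε * (A / (A + 1)) := by rw [integral_const_mul, ← hA]; ring
    _ ≤ ε * 1 := by
        gcongr
        exact div_le_one_of_le₀ (by linarith) (by linarith)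
    _ = ε := mul_one ε

/-- A function all of whose transforms `∫ (2 + t + c x) ^ (-3/2) g x dx` vanish is zero. -/
lemma ae_eq_zero_of_integral_inv_sqrt_pow_eq_zero (hc : Continuous c)
    (hc0 : ∀ x ∈ Ioi (0 : ℝ), 0 ≤ c x) (hd : Continuous d) (hd' : Tendsto d atTop atTop)
    (hdc : ∀ x ∈ Ioi (0 : ℝ), d (c x) = x) (hgm : AEStronglyMeasurable g muPlus)
    (hg : Integrable (fun x => (((√(1 + c x))⁻¹ ^ 3 : ℝ) : ℂ) * g x) muPlus)
    (h0 : ∀ t > 0, ∫ x, (((√(2 + t + c x))⁻¹ ^ 3 : ℝ) : ℂ) * g x ∂muPlus = 0) :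
    ∀ᵐ x ∂muPlus, g x = 0 := by
  have hI := integrableOn_inv_sqrt_pow hc hc0 hgm hg 0 one_pos
  rw [show (2 : ℝ) + 1 = 3 by norm_num] at hI
  norm_num only at hI
  have key : ∀ᵐ x ∂(volume : Measure ℝ), x ∈ Ioi (0 : ℝ) →
      (((√(3 + c x))⁻¹ ^ 3 : ℝ) : ℂ) * g x = 0 := by
    refine isOpen_Ioi.ae_eq_zero_of_integral_contDiff_smul_eq_zero
      (IntegrableOn.locallyIntegrableOn hI) fun ψ hψ hψs hψU => ?_
    obtain ⟨R, hR⟩ := hψs.isCompact.bddAbove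
    have hψR {y : ℝ} (hy : R < y) : ψ y = 0 :=
      image_eq_zero_of_notMem_tsupport fun h => (hR h).not_gt hy
    obtain ⟨Y, hY⟩ := eventually_atTop.1 (hd'.eventually_gt_atTop R)
    set φ : ℝ → ℝ := fun s => if s ≤ 0 then 0 else ψ (d (s⁻¹ - 3)) with hφ
    have hφc : Continuous φ := by
      refine continuous_iff_continuousAt.2 fun s => ?_
      rcases le_or_gt s 0 with hs | hs
      · have hY0 : 0 < |Y| + 3 := by positivity
        refine (continuousAt_const (y := (0 : ℝ))).congr ?_
        filter_upwards [Iio_mem_nhds (hs.trans_lt (inv_pos.2 hY0))] with r hr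
        simp only [hφ]
        split_ifs with h
        · rfl
        · refine (hψR (hY _ ?_)).symm
          have h1 := (lt_inv_comm₀ (not_le.1 h) hY0).1 hr
          linarith [le_abs_self Y]
      · have h1 : ContinuousAt (fun s => ψ (d (s⁻¹ - 3))) s :=
          hψ.continuous.continuousAt.comp (hd.continuousAt.comp
            ((continuousAt_inv₀ hs.ne').sub continuousAt_const))
        refine h1.congr ?_
        filter_upwards [Ioi_mem_nhds hs] with r hr
        simp [hφ, not_le.2 (show 0 < r from hr)]
    rw [← integral_comp_inv_mul_eq_zero hc hc0 hgm hg h0 hφc,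
      ← setIntegral_eq_integral_of_forall_compl_eq_zero (s := Ioi 0)]
    · refine setIntegral_congr_fun measurableSet_Ioi fun x hx => ?_
      have h1 := hc0 x hx
      have h2 : 0 < (3 + c x)⁻¹ := by positivity
      simp only [hφ, not_le.2 h2, if_false, inv_inv, add_sub_cancel_left, hdc x hx,
        Complex.real_smul]
    · intro x hx
      rw [image_eq_zero_of_notMem_tsupport fun h => hx (hψU h), zero_smul]
  rw [ae_restrict_iff' measurableSet_Ioi]
  filter_upwards [key] with x hx h
  have := hc0 x h
  refine (mul_eq_zero.1 (hx h)).resolve_left ?_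
  norm_cast
  positivity

end Moments

section Uniqueness

open Set Filter Topology

lemma cosh_two_pi_mul (x : ℝ) :
    Real.cosh (2 * Real.pi * x) = 1 + 2 * Real.sinh (Real.pi * x) ^ 2 := by
  have h := Real.cosh_sq (Real.pi * x)
  rw [mul_assoc, Real.cosh_two_mul]
  linarith

lemma tendsto_arsinh_sqrt :
    Tendsto (fun y : ℝ => Real.arsinh √(y / 2) / Real.pi) atTop atTop :=
  (Real.sinhOrderIso.symm.tendsto_atTop.comp (Real.tendsto_sqrt_atTop.comp
    (tendsto_id.atTop_div_const two_pos))).atTop_div_const Real.pi_pos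

lemma continuous_arsinh_sqrt : Continuous fun y : ℝ => Real.arsinh √(y / 2) / Real.pi :=
  (Real.continuous_arsinh.comp (by fun_prop)).div_const _

lemma memLp_ofReal_mul {f : ℝ → ℝ} {μ : Measure ℝ} (hf : MemLp f 2 μ) {u : ℝ → ℂ}
    (hu : MemLp u 2 μ) : Integrable (fun x => (f x : ℂ) * u x) μ :=
  MemLp.integrable_mul (hf.ofReal (K := ℂ)) hu

lemma eq_zero_of_integral_sinhKernel_eq_zero {u : L2plus}
    (h : ∀ᵐ x, ∫ t, (sinhKernel x t : ℂ) * u t ∂muPlus = 0) : u = 0 := by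
  have hpi := Real.pi_pos
  have hg : Integrable (fun t => (((√(1 + id t))⁻¹ ^ 3 : ℝ) : ℂ) * u t) muPlus := by
    refine memLp_ofReal_mul ?_ (Lp.memLp u)
    have hm : Measurable fun t : ℝ => (√(1 + id t))⁻¹ ^ 3 := by fun_prop
    rw [memLp_two_iff_integrable_sq hm.aestronglyMeasurable]
    refine integrable_inv_one_add_sq.integrableOn.mono' (hm.pow_const 2).aestronglyMeasurable ?_
    filter_upwards [ae_restrict_mem measurableSet_Ioi] with t (ht : 0 < t)
    rw [Real.norm_of_nonneg (by positivity), id, ← pow_mul, mul_comm, pow_mul, inv_pow,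
      Real.sq_sqrt (by positivity), inv_pow]
    refine inv_anti₀ (by positivity) ?_
    nlinarith [pow_pos ht 2, pow_pos ht 3]
  have hd (t : ℝ) (ht : 0 < t) := hasDerivAt_integral_inv_sqrt_pow (c := id) continuous_id
    (fun x hx => le_of_lt hx) (Lp.aestronglyMeasurable u) hg 0 ht
  simp only [mul_zero, zero_add, id] at hd
  set J : ℝ → ℂ := fun t => ∫ x, (((√(2 + t + x))⁻¹ ^ 3 : ℝ) : ℂ) * u x ∂muPlus with hJ
  set c : ℝ → ℝ := fun x => 2 * Real.sinh (Real.pi * x) ^ 2 with hc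
  have hcpos : ∀ x ∈ Ioi (0 : ℝ), 0 < c x := fun x (hx : 0 < x) => by
    have := Real.sinh_pos_iff.2 (mul_pos hpi hx)
    positivity
  have hae : (J ∘ c) =ᵐ[volume.restrict (Ioi 0)] fun _ => 0 := by
    filter_upwards [ae_restrict_of_ae h, ae_restrict_mem measurableSet_Ioi] with x hx hx0
    have hs : Real.sinh (2 * Real.pi * x) ≠ 0 :=
      (Real.sinh_pos_iff.2 (mul_pos (by positivity) hx0)).ne'
    refine (mul_eq_zero.1 (Eq.trans ?_ hx)).resolve_left (Complex.ofReal_ne_zero.2 hs)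
    rw [Function.comp_apply, hJ, ← integral_const_mul]
    congr 1
    ext t
    rw [sinhKernel, cosh_two_pi_mul, show 1 + t + (1 + 2 * Real.sinh (Real.pi * x) ^ 2) =
      2 + c x + t by rw [hc]; ring]
    push_cast
    ring
  have hcont : ContinuousOn (J ∘ c) (Ioi 0) := by
    have hcc : Continuous c := by
      have := Real.continuous_sinh
      fun_prop
    exact fun x hx => ((hd _ (hcpos x hx)).continuousAt.comp hcc.continuousAt).continuousWithinAt
  have hEq := Measure.eqOn_open_of_ae_eq hae isOpen_Ioi hcont continuousOn_const
  have h0 : ∀ t > 0, ∫ x, (((√(2 + t + id x))⁻¹ ^ 3 : ℝ) : ℂ) * u x ∂muPlus = 0 := by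
    intro t ht
    have h1 : 0 < Real.arsinh √(t / 2) / Real.pi :=
      div_pos (Real.arsinh_pos_iff.2 (by positivity)) hpi
    have h2 : c (Real.arsinh √(t / 2) / Real.pi) = t := by
      simp only [hc]
      rw [mul_div_cancel₀ _ hpi.ne', Real.sinh_arsinh, Real.sq_sqrt (by positivity)]
      ring
    have h3 : J (c (Real.arsinh √(t / 2) / Real.pi)) = 0 := hEq h1
    rwa [h2] at h3
  refine Lp.ext ?_
  filter_upwards [ae_eq_zero_of_integral_inv_sqrt_pow_eq_zero (d := id) continuous_id
    (fun x hx => le_of_lt hx) continuous_id tendsto_id (fun _ _ => rfl)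
    (Lp.aestronglyMeasurable u) hg h0, Lp.coeFn_zero ℂ 2 muPlus] with x h1 h2
  rw [h1, h2, Pi.zero_apply]

lemma memLp_sinhKernel {t : ℝ} (ht : -1 ≤ t) : MemLp (fun x => sinhKernel x t) 2 volume := by
  have hm : AEStronglyMeasurable (fun x => sinhKernel x t) volume :=
    (measurable_sinhKernel.comp (measurable_id.prodMk measurable_const)).aestronglyMeasurable
  rw [memLp_two_iff_integrable_sq hm]
  refine (integrable_sech.comp_mul_left' (two_ne_zero' ℝ)).mono' (hm.pow 2)
    (Eventually.of_forall fun x => ?_)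
  have hC := Real.cosh_pos (2 * Real.pi * x)
  have hR : 0 < 1 + t + Real.cosh (2 * Real.pi * x) := by linarith
  rw [Real.norm_of_nonneg (sq_nonneg _), sinhKernel, mul_pow, ← pow_mul, mul_comm 3 2, pow_mul,
    inv_pow (√_), Real.sq_sqrt hR.le, show Real.pi * (2 * x) = 2 * Real.pi * x by ring]
  have h1 := Real.cosh_sq (2 * Real.pi * x)
  calc _ ≤ Real.cosh (2 * Real.pi * x) ^ 2 * (Real.cosh (2 * Real.pi * x))⁻¹ ^ 3 :=
        mul_le_mul (by linarith) (pow_le_pow_left₀ (inv_nonneg.2 hR.le)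
          (inv_anti₀ hC (by linarith)) 3) (pow_nonneg (inv_nonneg.2 hR.le) 3) (sq_nonneg _)
    _ = _ := by field_simp

lemma reflection_eq_of_integral_sinhKernel_eq_zero {G : Lp ℂ 2 (volume : Measure ℝ)}
    (h : ∀ᵐ t ∂muPlus, ∫ x, (sinhKernel x t : ℂ) * G x = 0) : reflection G = G := by
  have hpi := Real.pi_pos
  set c : ℝ → ℝ := fun x => 2 * Real.sinh (Real.pi * x) ^ 2 with hc
  have hcc : Continuous c := by
    have := Real.continuous_sinh
    fun_prop
  have hcosh (x : ℝ) : Real.cosh (2 * Real.pi * x) = 1 + c x := cosh_two_pi_mul x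
  have hc0 : ∀ x ∈ Ioi (0 : ℝ), 0 ≤ c x := fun x _ => by positivity
  have hI {t : ℝ} (ht : -1 ≤ t) : Integrable fun x => (sinhKernel x t : ℂ) * G x :=
    memLp_ofReal_mul (memLp_sinhKernel ht) (Lp.memLp G)
  set g : ℝ → ℂ := fun x => (Real.sinh (2 * Real.pi * x) : ℂ) * (G x - G (-x)) with hg
  have hsplit (t x : ℝ) : (sinhKernel x t : ℂ) * G x + (sinhKernel (-x) t : ℂ) * G (-x) =
      (((√(1 + t + (1 + c x)))⁻¹ ^ 3 : ℝ) : ℂ) * g x := by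
    rw [sinhKernel_neg, sinhKernel, hcosh, hg]
    push_cast
    ring
  have hgm : AEStronglyMeasurable g muPlus := by
    refine AEStronglyMeasurable.mul (Measurable.aestronglyMeasurable ?_) ?_
    · have := Real.measurable_sinh
      fun_prop
    · exact ((Lp.aestronglyMeasurable G).sub
        ((Lp.aestronglyMeasurable G).comp_quasiMeasurePreserving
          measurePreserving_neg_real.quasiMeasurePreserving)).restrict
  have hgi : Integrable (fun x => (((√(1 + c x))⁻¹ ^ 3 : ℝ) : ℂ) * g x) muPlus := by
    have h1 := ((hI le_rfl).add (hI le_rfl).comp_neg).integrableOn (s := Ioi 0)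
    refine h1.congr (Eventually.of_forall fun x => ?_)
    rw [Pi.add_apply, hsplit]
    norm_num
  have hd (t : ℝ) (ht : 0 < t) := hasDerivAt_integral_inv_sqrt_pow hcc hc0 hgm hgi 0 ht
  simp only [mul_zero, zero_add] at hd
  have hae : (fun t => ∫ x, (((√(2 + t + c x))⁻¹ ^ 3 : ℝ) : ℂ) * g x ∂muPlus)
      =ᵐ[volume.restrict (Ioi 0)] fun _ => 0 := by
    filter_upwards [h, ae_restrict_mem measurableSet_Ioi] with t ht (ht0 : 0 < t)
    rw [← ht, integral_eq_integral_Ioi_add_neg (hI (by linarith))]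
    congr 1
    ext x
    rw [hsplit, show 1 + t + (1 + c x) = 2 + t + c x by ring]
  have hEq := Measure.eqOn_open_of_ae_eq hae isOpen_Ioi
    (fun t ht => (hd t ht).continuousAt.continuousWithinAt) continuousOn_const
  have h0 := ae_eq_zero_of_integral_inv_sqrt_pow_eq_zero hcc hc0 continuous_arsinh_sqrt
    tendsto_arsinh_sqrt (fun x (hx : 0 < x) => ?_) hgm hgi (fun t ht => hEq ht)
  · rw [ae_restrict_iff' measurableSet_Ioi] at h0
    have h1 : ∀ᵐ x : ℝ, 0 < x → G (-x) = G x := by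
      filter_upwards [h0] with x hx hx0
      have hs : Real.sinh (2 * Real.pi * x) ≠ 0 :=
        (Real.sinh_pos_iff.2 (mul_pos (by positivity) hx0)).ne'
      exact (sub_eq_zero.1 ((mul_eq_zero.1 (hx hx0)).resolve_left
        (Complex.ofReal_ne_zero.2 hs))).symm
    refine Lp.ext ?_
    filter_upwards [coeFn_reflection G, h1,
      measurePreserving_neg_real.quasiMeasurePreserving.ae h1,
      Measure.ae_ne volume (0 : ℝ)] with x h2 h3 h4 h5
    rw [h2]
    rcases h5.lt_or_gt with hx | hx
    · rw [← h4 (neg_pos.2 hx), neg_neg]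
    · exact h3 hx
  · simp only [hc]
    have hs := Real.sinh_pos_iff.2 (mul_pos hpi hx)
    rw [mul_div_cancel_left₀ _ two_ne_zero, Real.sqrt_sq hs.le, Real.arsinh_sinh,
      mul_div_cancel_left₀ _ hpi.ne']

end Uniqueness

section MehlerOperator

open Set Filter Topology
open scoped FourierTransform ENNReal

lemma exists_mehlerOperator : ∃ M : L2plus →L[ℂ] L2plus, IsSelfAdjoint M ∧
    ∀ u, ∀ᵐ t ∂muPlus, M u t = ∫ s, (mehlerKernel t s : ℂ) * u s ∂muPlus := by
  have hsymm (t s : ℝ) : mehlerKernel s t = mehlerKernel t s := by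
    rw [mehlerKernel, mehlerKernel, add_right_comm]
  have h1 : ∀ᵐ t ∂muPlus, ∫⁻ s, ‖mehlerKernel t s‖ₑ * schurWeight s ∂muPlus ≤
      4 * schurWeight t := by
    filter_upwards [ae_restrict_mem measurableSet_Ioi] with t ht
    exact lintegral_mehlerKernel_le ht
  obtain ⟨M, hM⟩ := exists_integralOperator measurable_mehlerKernel measurable_schurWeight
    measurable_schurWeight schurWeight_ne_zero schurWeight_ne_top (ENNReal.ofNat_ne_top (n := 4))
    (ENNReal.ofNat_ne_top (n := 4)) h1 (by simpa only [hsymm] using h1)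
  refine ⟨M, ?_, fun u => (hM u).2.1⟩
  rw [ContinuousLinearMap.isSelfAdjoint_iff_isSymmetric]
  intro v u
  rw [ContinuousLinearMap.coe_coe]
  refine (inner_integralOperator (hM u).2.1 ?_ ((hM u).2.2 v)).symm
  simpa only [hsymm] using (hM v).2.1

lemma exists_sinhOperator : ∃ W : L2plus →L[ℂ] Lp ℂ 2 (volume : Measure ℝ),
    (∀ u, ∀ᵐ x, W u x = ∫ t, (sinhKernel x t : ℂ) * u t ∂muPlus) ∧
    ∀ (u : L2plus) (v : Lp ℂ 2 (volume : Measure ℝ)), Integrable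
      (fun z : ℝ × ℝ => (sinhKernel z.1 z.2 : ℂ) * u z.2 * star (v z.1)) (volume.prod muPlus) := by
  obtain ⟨W, hW⟩ := exists_integralOperator (μ := (volume : Measure ℝ)) (ν := muPlus)
    measurable_sinhKernel measurable_schurWeight (q := fun _ => 1) measurable_const
    schurWeight_ne_zero schurWeight_ne_top (ENNReal.ofNat_ne_top (n := 2))
    (ENNReal.ofNat_ne_top (n := 2))
    (Eventually.of_forall fun x => (lintegral_sinhKernel_left_le x).trans_eq (mul_one _).symm) (by
      filter_upwards [ae_restrict_mem measurableSet_Ioi] with t ht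
      simpa only [mul_one] using lintegral_sinhKernel_right_le ht)
  exact ⟨W, fun u => (hW u).2.1, fun u => (hW u).2.2⟩

lemma exists_sinhOperator_transpose : ∃ W : Lp ℂ 2 (volume : Measure ℝ) →L[ℂ] L2plus,
    ∀ v, ∀ᵐ t ∂muPlus, W v t = ∫ x, (sinhKernel x t : ℂ) * v x := by
  obtain ⟨W, hW⟩ := exists_integralOperator (μ := muPlus) (ν := (volume : Measure ℝ))
    (k := fun t x => sinhKernel x t) (measurable_sinhKernel.comp measurable_swap)
    (p := fun _ => 1) measurable_const measurable_schurWeight (fun _ => one_ne_zero)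
    (fun _ => ENNReal.one_ne_top) (ENNReal.ofNat_ne_top (n := 2))
    (ENNReal.ofNat_ne_top (n := 2)) (by
      filter_upwards [ae_restrict_mem measurableSet_Ioi] with t ht
      simpa only [mul_one] using lintegral_sinhKernel_right_le ht)
    (Eventually.of_forall fun x => (lintegral_sinhKernel_left_le x).trans_eq (mul_one _).symm)
  exact ⟨W, fun v => (hW v).2.1⟩

lemma eq_zero_of_ae_eq_zero_of_reflection {F : Lp ℂ 2 (volume : Measure ℝ)} {c : ℂ}
    (hF : ∀ᵐ x ∂muPlus, F x = 0) (hc : reflection F = c • F) : F = 0 := by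
  rw [ae_restrict_iff' measurableSet_Ioi] at hF
  have hs : ∀ᵐ x : ℝ, F (-x) = c * F x := by
    filter_upwards [coeFn_reflection F, Lp.coeFn_smul c F] with x h1 h2
    rw [← h1, hc, h2, Pi.smul_apply, smul_eq_mul]
  refine Lp.ext ?_
  filter_upwards [hF, measurePreserving_neg_real.quasiMeasurePreserving.ae hF,
    measurePreserving_neg_real.quasiMeasurePreserving.ae hs, Measure.ae_ne volume (0 : ℝ),
    Lp.coeFn_zero ℂ 2 (volume : Measure ℝ)] with x h1 h2 h3 h4 h5
  rw [h5, Pi.zero_apply]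
  rcases h4.lt_or_gt with hx | hx
  · rw [neg_neg] at h3
    rw [h3, h2 (neg_pos.2 hx), mul_zero]
  · exact h1 hx

lemma reflection_sinhOperator {u : L2plus} {w : Lp ℂ 2 (volume : Measure ℝ)}
    (hw : ∀ᵐ x, w x = ∫ t, (sinhKernel x t : ℂ) * u t ∂muPlus) :
    reflection w = (-1 : ℂ) • w := by
  refine Lp.ext ?_
  filter_upwards [coeFn_reflection w, hw, Lp.coeFn_smul (-1 : ℂ) w,
    measurePreserving_neg_real.quasiMeasurePreserving.ae hw] with x h1 h2 h3 h4
  rw [h1, h3, h4, Pi.smul_apply, h2, smul_eq_mul, neg_one_mul, ← integral_neg]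
  simp only [sinhKernel_neg, Complex.ofReal_neg, neg_mul]

lemma exists_zeroExtension (h : L2plus) : ∃ k : Lp ℂ 2 (volume : Measure ℝ),
    k =ᵐ[volume] (Ioi (0 : ℝ)).indicator h := by
  have := (memLp_indicator_iff_restrict (f := h) measurableSet_Ioi).2 (Lp.memLp h)
  exact ⟨this.toLp, this.coeFn_toLp⟩

lemma inner_restrict_eq_inner_zeroExtension {h w : L2plus} {f k : Lp ℂ 2 (volume : Measure ℝ)}
    (hk : k =ᵐ[volume] (Ioi (0 : ℝ)).indicator h) (hw : w =ᵐ[muPlus] f) :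
    inner ℂ w h = inner ℂ f k := by
  rw [L2.inner_def, L2.inner_def]
  calc ∫ x, inner ℂ (w x) (h x) ∂muPlus = ∫ x in Ioi 0, inner ℂ (f x) (h x) := by
        refine integral_congr_ae ?_
        filter_upwards [hw] with x hx
        rw [hx]
    _ = ∫ x, (Ioi 0).indicator (fun x => inner ℂ (f x) (h x)) x :=
        (integral_indicator measurableSet_Ioi).symm
    _ = _ := by
        refine integral_congr_ae ?_
        filter_upwards [hk] with x hx
        rw [hx]
        by_cases hx0 : x ∈ Ioi (0 : ℝ)
        · simp only [indicator_of_mem hx0]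
        · simp only [indicator_of_notMem hx0, inner_zero_right]

lemma eq_zero_of_forall_inner_sinhOperator {W : L2plus →L[ℂ] Lp ℂ 2 (volume : Measure ℝ)}
    (hW : ∀ u, ∀ᵐ x, W u x = ∫ t, (sinhKernel x t : ℂ) * u t ∂muPlus)
    (hkint : ∀ (u : L2plus) (v : Lp ℂ 2 (volume : Measure ℝ)), Integrable
      (fun z : ℝ × ℝ => (sinhKernel z.1 z.2 : ℂ) * u z.2 * star (v z.1)) (volume.prod muPlus))
    {h : L2plus} {k : Lp ℂ 2 (volume : Measure ℝ)}
    (hk : k =ᵐ[volume] (Ioi (0 : ℝ)).indicator h)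
    (horth : ∀ u, inner ℂ (𝓕 (W u)) k = 0) : h = 0 := by
  obtain ⟨W', hW'⟩ := exists_sinhOperator_transpose
  have hG (u : L2plus) : inner ℂ (𝓕⁻ k) (W u) = 0 := by
    rw [← Lp.inner_fourier_eq, FourierTransform.fourier_fourierInv_eq,
      inner_eq_zero_symm, horth]
  have hW0 : W' (𝓕⁻ k) = 0 := by
    rw [← inner_self_eq_zero (𝕜 := ℂ),
      ← inner_integralOperator (hW _) (hW' (𝓕⁻ k)) (hkint _ _), hG]
  have hrefl : reflection (𝓕⁻ k) = 𝓕⁻ k := by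
    refine reflection_eq_of_integral_sinhKernel_eq_zero ?_
    filter_upwards [hW' (𝓕⁻ k), Lp.coeFn_zero ℂ 2 muPlus] with t h1 h2
    rw [← h1, hW0, h2, Pi.zero_apply]
  have hreflk : reflection k = k := by
    have h1 := fourier_reflection (𝓕⁻ k)
    rw [hrefl, FourierTransform.fourier_fourierInv_eq] at h1
    exact h1.symm
  have hk0 : k = 0 := by
    have hz : ∀ᵐ x ∂muPlus, reflection k x = 0 := by
      rw [ae_restrict_iff' measurableSet_Ioi]
      filter_upwards [coeFn_reflection k,
        measurePreserving_neg_real.quasiMeasurePreserving.ae hk] with x h1 h2 (hx : 0 < x)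
      rw [h1, h2, indicator_of_notMem (by simpa using hx.le)]
    rw [hreflk] at hz
    exact eq_zero_of_ae_eq_zero_of_reflection hz (hreflk.trans (one_smul ℂ k).symm)
  refine Lp.ext ?_
  filter_upwards [ae_restrict_of_ae hk, ae_restrict_mem measurableSet_Ioi,
    Lp.coeFn_zero ℂ 2 muPlus, ae_restrict_of_ae (Lp.coeFn_zero ℂ 2 (volume : Measure ℝ))]
    with x h1 h2 h3 h4
  rw [h3, Pi.zero_apply, ← indicator_of_mem h2 h, ← h1, hk0, h4, Pi.zero_apply]

theorem exists_diagonalization {M S : L2plus →L[ℂ] L2plus} (hMsa : IsSelfAdjoint M)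
    (hM : ∀ u, ∀ᵐ t ∂muPlus, M u t = ∫ s, (mehlerKernel t s : ℂ) * u s ∂muPlus)
    (hS : ∀ u : L2plus, ∀ᵐ τ ∂muPlus,
      S u τ = (((Real.cosh (Real.pi * τ))⁻¹ : ℝ) : ℂ) * u τ) :
    ∃ U : L2plus ≃ₗᵢ[ℂ] L2plus, ∀ u, U (M u) = S (U u) := by
  obtain ⟨W, hW, hkint⟩ := exists_sinhOperator
  let R := LpToLpRestrictCLM ℝ ℂ ℂ volume 2 (Ioi (0 : ℝ))
  let F : Lp ℂ 2 (volume : Measure ℝ) →L[ℂ] Lp ℂ 2 (volume : Measure ℝ) :=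
    (Lp.fourierTransformₗᵢ ℝ ℂ).toContinuousLinearEquiv
  have hR (f : Lp ℂ 2 (volume : Measure ℝ)) : R f =ᵐ[muPlus] f :=
    LpToLpRestrictCLM_coeFn ℂ (Ioi (0 : ℝ)) f
  have hV (u : L2plus) : (R ∘L F ∘L W) u =ᵐ[muPlus] (𝓕 (W u) : Lp ℂ 2 (volume : Measure ℝ)) :=
    hR (𝓕 (W u))
  refine exists_unitary_of_intertwining (W := R ∘L F ∘L W) hMsa (isSelfAdjoint_of_mul_real hS)
    ?_ (fun u hu => ?_) (fun h hh => ?_)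
  · refine ContinuousLinearMap.ext_on (dense_integrable.mono Submodule.subset_span)
      fun u hu => Lp.ext ?_
    filter_upwards [hV (M u), hS ((R ∘L F ∘L W) u), hV u,
      ae_restrict_of_ae (fourier_sinhOperator_mehler hM hW hu)] with ξ h1 h2 h3 h4
    exact h1.trans (h4.trans (by rw [mul_apply_eq_comp, h2, h3]))
  · refine eq_zero_of_integral_sinhKernel_eq_zero ?_
    have hodd : reflection (𝓕 (W u)) = (-1 : ℂ) • 𝓕 (W u) := by
      rw [← fourier_reflection, reflection_sinhOperator (hW u), FourierTransform.fourier_smul]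
    have h0 : (𝓕 (W u) : Lp ℂ 2 (volume : Measure ℝ)) = 0 := by
      refine eq_zero_of_ae_eq_zero_of_reflection ?_ hodd
      filter_upwards [hV u, Lp.coeFn_zero ℂ 2 muPlus] with x h1 h2
      rw [← h1, hu, h2, Pi.zero_apply]
    have hW0 : W u = 0 :=
      (Lp.fourierTransformₗᵢ ℝ ℂ).map_eq_zero_iff.1 h0
    filter_upwards [hW u, Lp.coeFn_zero ℂ 2 (volume : Measure ℝ)] with x h1 h2
    rw [← h1, hW0, h2, Pi.zero_apply]
  · obtain ⟨k, hk⟩ := exists_zeroExtension h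
    exact eq_zero_of_forall_inner_sinhOperator hW hkint hk fun u =>
      (inner_restrict_eq_inner_zeroExtension hk (hV u)).symm.trans (hh u)

lemma spectrum_eq_of_intertwining {H : Type*} [NormedAddCommGroup H] [InnerProductSpace ℂ H]
    {M S : H →L[ℂ] H} (U : H ≃ₗᵢ[ℂ] H) (hU : ∀ u, U (M u) = S (U u)) :
    spectrum ℂ M = spectrum ℂ S := by
  have h : U.toContinuousLinearEquiv.conjContinuousAlgEquiv M = S := by
    ext v
    simpa using hU (U.symm v)
  rw [← h]
  exact (AlgEquiv.spectrum_eq U.toContinuousLinearEquiv.conjContinuousAlgEquiv.toAlgEquiv M).symm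

end MehlerOperator

/-- The Mehler formula `(Mu)(t) = π⁻¹ ∫₀^∞ (2+t+s)⁻¹ u(s) ds` defines a
bounded self-adjoint operator on `L²(0,∞)` which is unitarily equivalent to multiplication
by `(cosh(πτ))⁻¹`; consequently its spectrum is `[0,1]` and it has no eigenvalues. -/
theorem stmt_6 :
    ∃ M : L2plus →L[ℂ] L2plus,
      (∀ u : L2plus, ∀ᵐ t ∂muPlus,
        (M u : ℝ → ℂ) t =
          (Real.pi : ℂ)⁻¹ * ∫ s in Set.Ioi (0 : ℝ), ((2 : ℂ) + (t : ℂ) + (s : ℂ))⁻¹ * u s) ∧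
      IsSelfAdjoint M ∧
      (∃ Ψ : L2plus ≃ₗᵢ[ℂ] L2plus, ∀ u : L2plus, ∀ᵐ τ ∂muPlus,
        (Ψ (M u) : ℝ → ℂ) τ = ((Real.cosh (Real.pi * τ) : ℝ) : ℂ)⁻¹ * (Ψ u : ℝ → ℂ) τ) ∧
      spectrum ℂ M = Complex.ofReal '' Set.Icc (0 : ℝ) 1 ∧
      (∀ (c : ℂ) (u : L2plus), M u = c • u → u = 0) := by
  obtain ⟨M, hMsa, hM⟩ := exists_mehlerOperator
  obtain ⟨S, hS⟩ := exists_mulOperator (μ := muPlus)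
    (f := fun τ => (((Real.cosh (Real.pi * τ))⁻¹ : ℝ) : ℂ))
    (Complex.measurable_ofReal.comp continuous_sech.measurable) (C := 1)
    (Filter.Eventually.of_forall fun τ => by
      rw [Complex.norm_real, Real.norm_of_nonneg (sech_mem_Icc τ).1]
      exact (sech_mem_Icc τ).2)
  obtain ⟨U, hU⟩ := exists_diagonalization hMsa hM hS
  refine ⟨M, fun u => ?_, hMsa, ⟨U, fun u => ?_⟩,
    (spectrum_eq_of_intertwining U hU).trans (spectrum_mul_sech hS), fun c u hu => ?_⟩
  · filter_upwards [hM u] with t ht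
    rw [ht, ← integral_const_mul]
    congr 1
    ext s
    rw [mehlerKernel]
    push_cast
    ring
  · filter_upwards [hS (U u)] with τ hτ
    rw [hU, hτ, Complex.ofReal_inv]
  · exact U.map_eq_zero_iff.1 (eq_zero_of_mul_sech_eq hS (by rw [← hU, hu, map_smul]))

end
end
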